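/- arXiv:1710.02308 — 6 statements merged into one kernel-verified Lean document; each statement's English description precedes it below -/
import Mathlib

section
/- (Hierarchy of martingales, finite-volume identity.) Let k∈ℕ, j_1,…,j_k∈V_n, and let g:ℝ^{V_n}×ℝ^{V_n}→ℂ be bounded and Borel measurable. Then ∫ ∏_{l=1}^{k} e^{u_{j_l}}(1+i s_{j_l}) · g((β^{V_{n+1}}_i(u))_{i∈V_n},(θ^{V_{n+1}}_i(u,s))_{i∈V_n}) dμ^W_{n+1}(u,s) = ∫ ∏_{l=1}^{k} e^{u_{j_l}}(1+i s_{j_l}) · g(β^{V_n}(u),θ^{V_n}(u,s)) dμ^W_n(u,s), where i denotes the imaginary unit. -/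
open MeasureTheory Real Finset BigOperators

noncomputable section

/-- The matrix `A^W(u)`: off-diagonal entries `-W i j * exp (u i + u j)`,
diagonal entries `∑ k, W i k * exp (u i + u k)`. -/
def Amat {V : Type*} [Fintype V] [DecidableEq V] (W : V → V → ℝ) (u : V → ℝ) :
    Matrix V V ℝ :=
  Matrix.of fun i j =>
    if i = j then ∑ k, W i k * Real.exp (u i + u k)
    else -(W i j * Real.exp (u i + u j))

/-- The restriction `A^W_{VV}(u)` of `A^W(u)` to `V×V` where `V = Ṽ∖{δ}`. -/
def AVV {V : Type*} [Fintype V] [DecidableEq V] (W : V → V → ℝ) (δ : V) (u : V → ℝ) :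
    Matrix {i : V // i ≠ δ} {i : V // i ≠ δ} ℝ :=
  Matrix.of fun i j => Amat W u i.1 j.1

/-- The density `ρ^W(u,s)`.  The product over undirected edges
`∏_{(i∼j)∈Ẽ} e^{−W_{ij}(cosh(u_i−u_j)−1)}` is written as
`exp(−(1/2)·Σ_{i,j} W_{ij}(cosh(u_i−u_j)−1))` (sum over all ordered pairs), which agrees
with it since `W` is symmetric and vanishes on the diagonal and off the edge set. -/
def rhoW {V : Type*} [Fintype V] [DecidableEq V] (W : V → V → ℝ) (δ : V) (u s : V → ℝ) :
    ℝ :=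
  Real.exp (-(1 / 2) * ∑ i, ∑ j, s i * Amat W u i j * s j)
    * (AVV W δ u).det
    * Real.exp (-((1 / 2) * ∑ i, ∑ j, W i j * (Real.cosh (u i - u j) - 1)))

/-- Extension of a vector indexed by `V = Ṽ∖{δ}` to `Ṽ` by the value `0` at `δ`. -/
def extendByZero {V : Type*} [DecidableEq V] (δ : V) (x : {i : V // i ≠ δ} → ℝ) : V → ℝ :=
  fun i => if h : i = δ then 0 else x ⟨i, h⟩

/-- The reference measure on `(ℝ^Ṽ)×(ℝ^Ṽ)`: Lebesgue measure on the coordinates in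
`V = Ṽ∖{δ}`, with the coordinates at `δ` fixed to `0` (Dirac measure at `0`). -/
def baseMeasure {V : Type*} [Fintype V] [DecidableEq V] (δ : V) :
    Measure ((V → ℝ) × (V → ℝ)) :=
  Measure.map
    (fun p : ({i : V // i ≠ δ} → ℝ) × ({i : V // i ≠ δ} → ℝ) =>
      (extendByZero δ p.1, extendByZero δ p.2))
    volume

/-- The measure `μ^W(du ds) = ρ^W(u,s)·∏_{i∈V}(2π)^{−1} e^{−u_i} du_i ds_i` on `Ω_V`. -/
def muW {V : Type*} [Fintype V] [DecidableEq V] (W : V → V → ℝ) (δ : V) :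
    Measure ((V → ℝ) × (V → ℝ)) :=
  (baseMeasure δ).withDensity fun p =>
    ENNReal.ofReal (rhoW W δ p.1 p.2 *
      ∏ i : {i : V // i ≠ δ}, Real.exp (-(p.1 i.1)) / (2 * Real.pi))

/-- `β_i(u) = (1/2)·Σ_j W_{ij} e^{u_j−u_i}`. -/
def betaW {V : Type*} [Fintype V] (W : V → V → ℝ) (u : V → ℝ) (i : V) : ℝ :=
  (1 / 2) * ∑ j, W i j * Real.exp (u j - u i)

/-- `θ_i(u,s) = Σ_j W_{ij} e^{u_j}(s_i−s_j)`. -/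
def thetaW {V : Type*} [Fintype V] (W : V → V → ℝ) (u s : V → ℝ) (i : V) : ℝ :=
  ∑ j, W i j * Real.exp (u j) * (s i - s j)

/-- The weights of the wired finite graph `G̃_S` with vertex set `S ∪ {δ_S}`, encoded as
`Option {i // i ∈ S}` with `none` playing the role of the distinguished vertex `δ_S`:
`W^{(S)}_{ij} = W_{ij}` for `i,j ∈ S` and `W^{(S)}_{iδ_S} = Σ_{j∉S} W_{ij}`. -/
def wiredW {Vinf : Type*} (W : Vinf → Vinf → ℝ) (S : Finset Vinf) :
    Option {i : Vinf // i ∈ S} → Option {i : Vinf // i ∈ S} → ℝ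
  | some i, some j => W i.1 j.1
  | some i, none => ∑' j : {j : Vinf // j ∉ S}, W i.1 j.1
  | none, some j => ∑' k : {k : Vinf // k ∉ S}, W j.1 k.1
  | none, none => 0


/-! ### Linear algebra of `H_β = 2β - P` -/

/-- The matrix `H_β = 2β - P`. -/
def Hm {V : Type*} [DecidableEq V] (P : V → V → ℝ) (β : V → ℝ) : Matrix V V ℝ :=
  Matrix.of fun i j => (if i = j then 2 * β i else 0) - P i j

/-- The field `β(u)` with pinning `η`. -/
def bF {V : Type*} [Fintype V] (P : V → V → ℝ) (η : V → ℝ) (u : V → ℝ) : V → ℝ :=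
  fun i => (1 / 2) * (∑ j, P i j * Real.exp (u j - u i) + η i * Real.exp (- u i))

/-- Standing assumptions on weights and pinning. -/
structure Good {V : Type*} (P : V → V → ℝ) (η : V → ℝ) : Prop where
  symm : ∀ i j, P i j = P j i
  diag : ∀ i, P i i = 0
  nonneg : ∀ i j, 0 ≤ P i j
  eta : ∀ i, 0 ≤ η i
  conn : ∀ S : Set V, S.Nonempty → ∃ i ∈ S, 0 < η i ∨ ∃ j, j ∉ S ∧ 0 < P i j

section LA
set_option linter.unusedSectionVars false
variable {V : Type*} [Fintype V] [DecidableEq V] {P : V → V → ℝ} {η : V → ℝ}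

lemma Hm_mulVec (β x : V → ℝ) (i : V) :
    (Hm P β).mulVec x i = 2 * β i * x i - ∑ j, P i j * x j := by
  simp [Hm, Matrix.mulVec, dotProduct, sub_mul, Finset.sum_sub_distrib]

lemma Hm_herm (h : Good P η) (β : V → ℝ) : (Hm P β).IsHermitian := by
  ext i j
  simp only [Hm, Matrix.conjTranspose_apply, Matrix.of_apply, star_trivial]
  rw [h.symm i j]
  by_cases hij : i = j
  · subst hij; rfl
  · rw [if_neg hij, if_neg (Ne.symm hij)]

lemma posDef_iff (h : Good P η) (β : V → ℝ) :
    (Hm P β).PosDef ↔ ∀ x : V → ℝ, x ≠ 0 → 0 < x ⬝ᵥ (Hm P β).mulVec x := by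
  rw [Matrix.posDef_iff_dotProduct_mulVec]
  exact ⟨fun hh x hx => hh.2 hx, fun hh => ⟨Hm_herm h β, fun x hx => hh x hx⟩⟩

/-- Dirichlet form identity. -/
lemma quad_bF (h : Good P η) (u s : V → ℝ) :
    (fun i => Real.exp (u i) * s i) ⬝ᵥ
      (Hm P (bF P η u)).mulVec (fun i => Real.exp (u i) * s i)
    = (1 / 2) * ∑ i, ∑ j, P i j * Real.exp (u i + u j) * (s i - s j) ^ 2
      + ∑ i, η i * Real.exp (u i) * s i ^ 2 := by
  have h1 : ∑ i, ∑ j, P i j * Real.exp (u i + u j) * s j ^ 2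
      = ∑ i, ∑ j, P i j * Real.exp (u i + u j) * s i ^ 2 := by
    rw [Finset.sum_comm]
    refine Finset.sum_congr rfl fun i _ => Finset.sum_congr rfl fun j _ => ?_
    rw [h.symm j i, add_comm (u j)]
  have h2 : ∑ i, ∑ j, P i j * Real.exp (u i + u j) * (s i - s j) ^ 2
      = 2 * ∑ i, ∑ j, P i j * Real.exp (u i + u j) * s i ^ 2
        - 2 * ∑ i, ∑ j, P i j * Real.exp (u i + u j) * (s i * s j) := by
    have : ∑ i, ∑ j, P i j * Real.exp (u i + u j) * (s i - s j) ^ 2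
      = ∑ i, ∑ j, P i j * Real.exp (u i + u j) * s i ^ 2
        + ∑ i, ∑ j, P i j * Real.exp (u i + u j) * s j ^ 2
        - 2 * ∑ i, ∑ j, P i j * Real.exp (u i + u j) * (s i * s j) := by
      simp only [Finset.mul_sum, ← Finset.sum_add_distrib, ← Finset.sum_sub_distrib]
      refine Finset.sum_congr rfl fun i _ => Finset.sum_congr rfl fun j _ => ?_
      ring
    rw [this, h1]; ring
  rw [h2]
  simp only [dotProduct, Hm_mulVec, bF]
  have h3 : (1 / 2 : ℝ) * (2 * ∑ i, ∑ j, P i j * Real.exp (u i + u j) * s i ^ 2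
        - 2 * ∑ i, ∑ j, P i j * Real.exp (u i + u j) * (s i * s j))
      + ∑ i, η i * Real.exp (u i) * s i ^ 2 =
      ∑ i, ((∑ j, P i j * Real.exp (u i + u j) * s i ^ 2
        - ∑ j, P i j * Real.exp (u i + u j) * (s i * s j)) + η i * Real.exp (u i) * s i ^ 2) := by
    rw [Finset.sum_add_distrib, Finset.sum_sub_distrib]; ring
  rw [h3]
  refine Finset.sum_congr rfl fun i _ => ?_
  have e1 : ∀ j, P i j * Real.exp (u i + u j) * s i ^ 2
      = Real.exp (u i) ^ 2 * s i ^ 2 * (P i j * Real.exp (u j - u i)) := fun j => by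
    rw [Real.exp_add, Real.exp_sub]; field_simp
  have e2 : ∀ j, P i j * Real.exp (u i + u j) * (s i * s j)
      = Real.exp (u i) * s i * (P i j * (Real.exp (u j) * s j)) := fun j => by
    rw [Real.exp_add]; ring
  simp only [e1, e2, ← Finset.mul_sum]
  rw [Real.exp_neg]
  field_simp
  ring

lemma posDef_bF (h : Good P η) (u : V → ℝ) : (Hm P (bF P η u)).PosDef := by
  rw [posDef_iff h]
  intro y hy
  set s : V → ℝ := fun i => Real.exp (- u i) * y i with hs
  have hys : y = fun i => Real.exp (u i) * s i := by
    funext i; simp only [hs, ← mul_assoc, ← Real.exp_add]; simp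
  have hs0 : ∃ i, s i ≠ 0 := by
    by_contra hc
    push Not at hc
    exact hy (by rw [hys]; funext i; simp [hc i])
  rw [hys, quad_bF h]
  have p1 : ∀ i j, 0 ≤ P i j * Real.exp (u i + u j) * (s i - s j) ^ 2 := fun i j =>
    mul_nonneg (mul_nonneg (h.nonneg i j) (Real.exp_pos _).le) (sq_nonneg _)
  have p2 : ∀ i, 0 ≤ η i * Real.exp (u i) * s i ^ 2 := fun i =>
    mul_nonneg (mul_nonneg (h.eta i) (Real.exp_pos _).le) (sq_nonneg _)
  have P1 : 0 ≤ ∑ i, ∑ j, P i j * Real.exp (u i + u j) * (s i - s j) ^ 2 :=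
    Finset.sum_nonneg fun i _ => Finset.sum_nonneg fun j _ => p1 i j
  have P2 : 0 ≤ ∑ i, η i * Real.exp (u i) * s i ^ 2 := Finset.sum_nonneg fun i _ => p2 i
  obtain ⟨i, hi, h'⟩ := h.conn {i | s i ≠ 0} hs0
  rcases h' with h' | ⟨j, hj, h'⟩
  · have : 0 < ∑ i, η i * Real.exp (u i) * s i ^ 2 := by
      refine Finset.sum_pos' (fun i _ => p2 i) ⟨i, Finset.mem_univ _, ?_⟩
      have := Real.exp_pos (u i)
      have : 0 < s i ^ 2 := by have := hi; simp only [Set.mem_ofPred_eq] at this; positivity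
      positivity
    linarith
  · have : 0 < ∑ i, ∑ j, P i j * Real.exp (u i + u j) * (s i - s j) ^ 2 := by
      refine Finset.sum_pos' (fun i _ => Finset.sum_nonneg fun j _ => p1 i j)
        ⟨i, Finset.mem_univ _, ?_⟩
      refine Finset.sum_pos' (fun j _ => p1 i j) ⟨j, Finset.mem_univ _, ?_⟩
      have hj0 : s j = 0 := by simpa using hj
      have : 0 < (s i - s j) ^ 2 := by
        have := hi; simp only [Set.mem_ofPred_eq] at this
        rw [hj0, sub_zero]; positivity
      have := Real.exp_pos (u i + u j)
      positivity
    linarith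

lemma Hm_isUnit {β : V → ℝ} (hp : (Hm P β).PosDef) : IsUnit (Hm P β).det :=
  (Matrix.PosDef.det_pos hp).ne'.isUnit

lemma inv_mulVec_eq {β : V → ℝ} (hp : (Hm P β).PosDef) {x v : V → ℝ}
    (hx : (Hm P β).mulVec x = v) : (Hm P β)⁻¹.mulVec v = x := by
  rw [← hx, Matrix.mulVec_mulVec, Matrix.nonsing_inv_mul _ (Hm_isUnit hp), Matrix.one_mulVec]

lemma mulVec_inv {β : V → ℝ} (hp : (Hm P β).PosDef) (v : V → ℝ) :
    (Hm P β).mulVec ((Hm P β)⁻¹.mulVec v) = v := by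
  rw [Matrix.mulVec_mulVec, Matrix.mul_nonsing_inv _ (Hm_isUnit hp), Matrix.one_mulVec]

lemma Hm_bF_exp (u : V → ℝ) :
    (Hm P (bF P η u)).mulVec (fun i => Real.exp (u i)) = η := by
  funext i
  rw [Hm_mulVec, bF]
  have : ∀ j, P i j * Real.exp (u j) = Real.exp (u i) * (P i j * Real.exp (u j - u i)) := by
    intro j; rw [Real.exp_sub]; field_simp
  simp only [this, ← Finset.mul_sum]
  rw [Real.exp_neg]; field_simp; ring

lemma inv_eta_bF (h : Good P η) (u : V → ℝ) :
    (Hm P (bF P η u))⁻¹.mulVec η = fun i => Real.exp (u i) :=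
  inv_mulVec_eq (posDef_bF h u) (Hm_bF_exp u)

lemma inv_eta_pos (h : Good P η) {β : V → ℝ} (hp : (Hm P β).PosDef) (i : V) :
    0 < (Hm P β)⁻¹.mulVec η i := by
  set x := (Hm P β)⁻¹.mulVec η with hx
  have hHx : (Hm P β).mulVec x = η := mulVec_inv hp η
  have hnn : ∀ i, 0 ≤ x i := by
    set m : V → ℝ := fun i => max (- x i) 0 with hm
    have hm0 : ∀ i, 0 ≤ m i := fun i => le_max_right _ _
    by_contra hc
    push Not at hc
    obtain ⟨i, hi⟩ := hc
    have hmne : m ≠ 0 := fun h0 => by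
      have := congrFun h0 i
      simp only [hm, Pi.zero_apply] at this
      have := le_max_left (- x i) 0
      linarith
    have hq := (posDef_iff h β).1 hp m hmne
    have e : m ⬝ᵥ (Hm P β).mulVec m = m ⬝ᵥ (Hm P β).mulVec (x + m) - m ⬝ᵥ η := by
      rw [Matrix.mulVec_add, dotProduct_add, hHx]; ring
    have e1 : 0 ≤ m ⬝ᵥ η := Finset.sum_nonneg fun i _ => mul_nonneg (hm0 i) (h.eta i)
    have hxm : ∀ i, 0 ≤ x i + m i := fun i => by
      have := le_max_left (- x i) 0; simp only [hm]; linarith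
    have hxm0 : ∀ i, m i * (x i + m i) = 0 := fun i => by
      rcases le_total (x i) 0 with h1 | h1
      · simp [hm, max_eq_left (neg_nonneg.2 h1)]
      · simp [hm, max_eq_right (neg_nonpos.2 h1)]
    have e2 : m ⬝ᵥ (Hm P β).mulVec (x + m) ≤ 0 := by
      refine Finset.sum_nonpos fun i _ => ?_
      rw [Hm_mulVec]
      have : 0 ≤ m i * ∑ j, P i j * (x + m) j :=
        mul_nonneg (hm0 i) (Finset.sum_nonneg fun j _ => mul_nonneg (h.nonneg i j) (hxm j))
      have h3 := hxm0 i
      have : m i * (2 * β i * (x + m) i - ∑ j, P i j * (x + m) j)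
        = 2 * β i * (m i * (x i + m i)) - m i * ∑ j, P i j * (x + m) j := by
        simp only [Pi.add_apply]; ring
      rw [this, h3]; linarith
    linarith
  by_contra hc
  have hi0 : x i = 0 := le_antisymm (not_lt.1 hc) (hnn i)
  obtain ⟨j, hj, hj'⟩ := h.conn {i | x i = 0} ⟨i, hi0⟩
  have hrow := congrFun hHx j
  rw [Hm_mulVec, show x j = 0 from hj] at hrow
  have hs : 0 ≤ ∑ l, P j l * x l := Finset.sum_nonneg fun l _ => mul_nonneg (h.nonneg j l) (hnn l)
  rcases hj' with h1 | ⟨l, hl, h1⟩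
  · linarith
  · have : 0 < ∑ l, P j l * x l := by
      refine Finset.sum_pos' (fun l _ => mul_nonneg (h.nonneg j l) (hnn l))
        ⟨l, Finset.mem_univ _, mul_pos h1 (lt_of_le_of_ne (hnn l) (Ne.symm hl))⟩
    have := h.eta j
    linarith

lemma bF_inj (h : Good P η) : Function.Injective (bF P η) := by
  intro u v huv
  have h1 := inv_eta_bF h u
  rw [huv, inv_eta_bF h v] at h1
  funext i
  exact (Real.exp_injective (congrFun h1 i)).symm

lemma bF_range (h : Good P η) : Set.range (bF P η) = {β | (Hm P β).PosDef} := by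
  ext β
  constructor
  · rintro ⟨u, rfl⟩; exact posDef_bF h u
  · intro hp
    have hpos := inv_eta_pos h hp
    refine ⟨fun i => Real.log ((Hm P β)⁻¹.mulVec η i), ?_⟩
    funext i
    have hrow := congrFun (mulVec_inv hp η) i
    rw [Hm_mulVec] at hrow
    simp only [bF, Real.exp_sub, Real.exp_neg, Real.exp_log (hpos _)]
    have := (hpos i).ne'
    have e : ∀ j, P i j * ((Hm P β)⁻¹.mulVec η j / (Hm P β)⁻¹.mulVec η i)
      = (P i j * (Hm P β)⁻¹.mulVec η j) / (Hm P β)⁻¹.mulVec η i := fun j => by ring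
    simp only [e, ← Finset.sum_div]
    field_simp
    linarith

end LA

/-! ### Change of variables to `(β, θ)` -/

/-- The `θ` field in flattened coordinates. -/
def tF {V : Type*} [Fintype V] [DecidableEq V] (P : V → V → ℝ) (η : V → ℝ) (u s : V → ℝ) :
    V → ℝ :=
  (Hm P (bF P η u)).mulVec (fun i => Real.exp (u i) * s i)

open Classical in
/-- Joint density of `(β, θ)`. -/
def nuR {V : Type*} [Fintype V] [DecidableEq V] (P : V → V → ℝ) (η : V → ℝ)
    (p : (V → ℝ) × (V → ℝ)) : ℝ :=
  if (Hm P p.1).PosDef then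
    Real.exp (-(1 / 2) * (∑ i, ∑ j, Hm P p.1 i j) + ∑ i, η i
      - (1 / 2) * (η ⬝ᵥ (Hm P p.1)⁻¹.mulVec η) - (1 / 2) * (p.2 ⬝ᵥ (Hm P p.1)⁻¹.mulVec p.2))
      / (Hm P p.1).det / Real.pi ^ Fintype.card V
  else 0

/-- Joint density of `(u, s)`, flattened. -/
def muD {V : Type*} [Fintype V] [DecidableEq V] (P : V → V → ℝ) (η : V → ℝ)
    (p : (V → ℝ) × (V → ℝ)) : ℝ :=
  Real.exp (-(1 / 2) * ((fun i => Real.exp (p.1 i) * p.2 i) ⬝ᵥ tF P η p.1 p.2))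
    * (Hm P (bF P η p.1)).det * (∏ i, Real.exp (p.1 i)) / (2 * Real.pi) ^ Fintype.card V
    * Real.exp (-((1 / 2) * (∑ i, ∑ j, P i j * (Real.cosh (p.1 i - p.1 j) - 1))
        + ∑ i, η i * (Real.cosh (p.1 i) - 1)))

section CV
set_option linter.unusedSectionVars false
variable {V : Type*} [Fintype V] [DecidableEq V] {P : V → V → ℝ} {η : V → ℝ}

lemma muD_nonneg (h : Good P η) (p : (V → ℝ) × (V → ℝ)) : 0 ≤ muD P η p := by
  have := (posDef_bF h p.1).det_pos
  have h2 : 0 < ∏ i, Real.exp (p.1 i) := Finset.prod_pos fun i _ => Real.exp_pos _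
  unfold muD
  have := Real.pi_pos
  positivity

lemma nuR_nonneg (p : (V → ℝ) × (V → ℝ)) : 0 ≤ nuR P η p := by
  unfold nuR
  split_ifs with hp
  · have := hp.det_pos
    have := Real.pi_pos
    positivity
  · exact le_rfl

lemma inv_theta (h : Good P η) (u s : V → ℝ) :
    (Hm P (bF P η u))⁻¹.mulVec (tF P η u s) = fun i => Real.exp (u i) * s i :=
  inv_mulVec_eq (posDef_bF h u) rfl

lemma dens_eq (h : Good P η) (u s : V → ℝ) :
    muD P η (u, s) = ((1 / 2) ^ Fintype.card V * (Hm P (bF P η u)).det) *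
      ((Hm P (bF P η u)).det * ∏ i, Real.exp (u i)) * nuR P η (bF P η u, tF P η u s) := by
  have hp := posDef_bF h u
  have hd := hp.det_pos
  have hpi := Real.pi_pos
  unfold muD nuR
  rw [if_pos hp]
  simp only
  rw [inv_eta_bF h, inv_theta h, dotProduct_comm (tF P η u s)]
  have e1 : ∑ i, ∑ j, Hm P (bF P η u) i j = ∑ i, ∑ j, P i j * (Real.exp (u j - u i))
      + ∑ i, η i * Real.exp (- u i) - ∑ i, ∑ j, P i j := by
    have : ∀ i, ∑ j, Hm P (bF P η u) i j = ∑ j, P i j * (Real.exp (u j - u i))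
      + η i * Real.exp (- u i) - ∑ j, P i j := by
      intro i
      simp only [Hm, Matrix.of_apply, Finset.sum_sub_distrib, Finset.sum_ite_eq,
        Finset.mem_univ, if_true, bF]
      ring
    simp only [this, Finset.sum_sub_distrib, Finset.sum_add_distrib]
  have e2 : ∑ i, ∑ j, P i j * (Real.exp (u j - u i)) = ∑ i, ∑ j, P i j * Real.cosh (u i - u j) := by
    have e3 : ∑ i, ∑ j, P i j * (Real.exp (u j - u i)) = ∑ i, ∑ j, P i j * (Real.exp (u i - u j)) := by
      rw [Finset.sum_comm]
      refine Finset.sum_congr rfl fun i _ => Finset.sum_congr rfl fun j _ => ?_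
      rw [h.symm j i]
    have e4 : ∑ i, ∑ j, P i j * Real.cosh (u i - u j)
      = (1 / 2) * (∑ i, ∑ j, P i j * (Real.exp (u i - u j))
        + ∑ i, ∑ j, P i j * (Real.exp (u j - u i))) := by
      simp only [Finset.mul_sum, ← Finset.sum_add_distrib]
      refine Finset.sum_congr rfl fun i _ => Finset.sum_congr rfl fun j _ => ?_
      rw [Real.cosh_eq, neg_sub]; ring
    rw [e4, ← e3]; ring
  have e5 : ∑ i, η i * (Real.cosh (u i) - 1) = (1 / 2) * (∑ i, η i * Real.exp (u i)
      + ∑ i, η i * Real.exp (- u i)) - ∑ i, η i := by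
    simp only [Finset.mul_sum, ← Finset.sum_add_distrib, ← Finset.sum_sub_distrib]
    refine Finset.sum_congr rfl fun i _ => ?_
    rw [Real.cosh_eq]; ring
  have e6 : ∑ i, ∑ j, P i j * (Real.cosh (u i - u j) - 1)
      = ∑ i, ∑ j, P i j * Real.cosh (u i - u j) - ∑ i, ∑ j, P i j := by
    simp only [mul_sub, mul_one, Finset.sum_sub_distrib]
  rw [e1, e2, e5, e6]
  simp only [dotProduct]
  set Q := ∑ i, Real.exp (u i) * s i * tF P η u s i
  set C := ∑ i, ∑ j, P i j * Real.cosh (u i - u j)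
  set E := ∑ i, η i * Real.exp (- u i)
  set E' := ∑ i, η i * Real.exp (u i)
  set p := ∑ i, ∑ j, P i j
  set n := ∑ i, η i
  have e7 : Real.exp (-(1 / 2) * (C + E - p) + n - 1 / 2 * E' - 1 / 2 * Q)
    = Real.exp (-(1 / 2) * Q) * Real.exp (-(1 / 2 * (C - p) + (1 / 2 * (E' + E) - n))) := by
    rw [← Real.exp_add]; congr 1; ring
  rw [e7, mul_pow, div_pow, one_pow]
  field_simp

/-- Derivative matrix of `bF`. -/
lemma bF_hasFDerivAt (h : Good P η) (u : V → ℝ) :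
    HasFDerivAt (bF P η) (LinearMap.toContinuousLinearMap (Matrix.toLin' (Matrix.of fun i j =>
      (1 / 2) * (P i j * Real.exp (u j - u i)) - if i = j then bF P η u i else 0))) u := by
  rw [hasFDerivAt_pi']
  intro i
  have h1 : HasFDerivAt (fun u : V → ℝ => bF P η u i)
      ((1 / 2 : ℝ) • (∑ j, P i j • (Real.exp (u j - u i) •
        (ContinuousLinearMap.proj (R := ℝ) (φ := fun _ : V => ℝ) j
          - ContinuousLinearMap.proj (R := ℝ) (φ := fun _ : V => ℝ) i))
        + η i • (Real.exp (- u i) • - ContinuousLinearMap.proj (R := ℝ) (φ := fun _ : V => ℝ) i)))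
      u := by
    unfold bF
    refine HasFDerivAt.const_mul (HasFDerivAt.add (HasFDerivAt.fun_sum fun j _ => ?_) ?_) _
    · exact (((hasFDerivAt_apply j u).sub (hasFDerivAt_apply i u)).exp).const_mul _
    · exact (((hasFDerivAt_apply i u).neg).exp).const_mul _
  refine h1.congr_fderiv ?_
  ext v
  simp [Matrix.mulVec, dotProduct, sub_mul, Finset.sum_sub_distrib, bF, Finset.mul_sum,
    Finset.sum_mul, mul_sub, mul_add]
  simp only [← Finset.sum_mul, ← Finset.mul_sum, add_mul]
  have e1 : ∑ x, P i x * (Real.exp (u x - u i) * v i) = (∑ x, P i x * Real.exp (u x - u i)) * v i := by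
    rw [Finset.sum_mul]; exact Finset.sum_congr rfl fun x _ => by ring
  have e2 : ∑ x, P i x * (Real.exp (u x - u i) * v x) = ∑ x, P i x * Real.exp (u x - u i) * v x := by
    exact Finset.sum_congr rfl fun x _ => by ring
  have e3 : ∑ x, 2⁻¹ * (P i x * Real.exp (u x - u i)) * v x
    = 2⁻¹ * ∑ x, P i x * Real.exp (u x - u i) * v x := by
    rw [Finset.mul_sum]; exact Finset.sum_congr rfl fun x _ => by ring
  rw [e1, e2, e3]
  ring

lemma det_bF (u : V → ℝ) :
    (LinearMap.toContinuousLinearMap (Matrix.toLin' (Matrix.of fun i j =>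
      (1 / 2) * (P i j * Real.exp (u j - u i)) - if i = j then bF P η u i else 0))).det
    = (-(1 / 2)) ^ Fintype.card V * (Hm P (bF P η u)).det := by
  rw [LinearMap.det_toContinuousLinearMap, LinearMap.det_toLin']
  have : (Matrix.of fun i j =>
      (1 / 2) * (P i j * Real.exp (u j - u i)) - if i = j then bF P η u i else 0)
    = (-(1 / 2) : ℝ) • (Matrix.diagonal (fun i => Real.exp (- u i)) * Hm P (bF P η u)
      * Matrix.diagonal (fun i => Real.exp (u i))) := by
    ext i j
    simp only [Matrix.smul_apply, Matrix.mul_diagonal, Matrix.diagonal_mul, Hm, Matrix.of_apply,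
      smul_eq_mul]
    by_cases hij : i = j
    · subst hij
      simp only [if_true, sub_self, Real.exp_zero, Real.exp_neg]
      field_simp
      ring
    · simp only [if_neg hij, Real.exp_sub, Real.exp_neg]
      field_simp
      ring
  rw [this, Matrix.det_smul, Matrix.det_mul, Matrix.det_mul, Matrix.det_diagonal,
    Matrix.det_diagonal, ← Real.exp_sum, ← Real.exp_sum, mul_comm (Real.exp _), mul_assoc,
    ← Real.exp_add]
  simp

lemma measurableSet_posDef (h : Good P η) : MeasurableSet {β | (Hm P β).PosDef} := by
  rw [← bF_range h, ← Set.image_univ]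
  exact measurable_image_of_fderivWithin MeasurableSet.univ
    (fun u _ => (bF_hasFDerivAt h u).hasFDerivWithinAt) (bF_inj h).injOn

lemma continuous_Hm : Continuous (Hm P) := by
  refine continuous_matrix fun i j => ?_
  simp only [Hm, Matrix.of_apply]
  split_ifs <;> fun_prop

lemma measurable_inv (i j : V) : Measurable fun β : V → ℝ => (Hm P β)⁻¹ i j := by
  have e : (fun β : V → ℝ => (Hm P β)⁻¹ i j)
    = fun β => ((Hm P β).det)⁻¹ * (Hm P β).adjugate i j := by
    funext β
    rw [Matrix.inv_def, Ring.inverse_eq_inv', Matrix.smul_apply, smul_eq_mul]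
  rw [e]
  refine Measurable.mul (Measurable.inv ?_) ?_
  · exact (continuous_Hm.matrix_det).measurable
  · exact ((continuous_Hm.matrix_adjugate).matrix_elem i j).measurable

lemma measurable_inv_mulVec {α : Type*} [MeasurableSpace α] {b v : α → V → ℝ}
    (hb : Measurable b) (hv : Measurable v) (i : V) :
    Measurable fun a => (Hm P (b a))⁻¹.mulVec (v a) i := by
  simp only [Matrix.mulVec, dotProduct]
  refine Finset.measurable_sum _ fun j _ => ?_
  exact ((measurable_inv i j).comp hb).mul ((measurable_pi_apply j).comp hv)

lemma measurable_nuR (h : Good P η) : Measurable (nuR P η) := by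
  unfold nuR
  refine Measurable.ite (measurableSet_posDef h |>.preimage measurable_fst) ?_ measurable_const
  refine ((Real.measurable_exp.comp ?_).div ?_).div_const _
  · refine ((Measurable.add ?_ measurable_const).sub ?_).sub ?_
    · refine Measurable.const_mul (Finset.measurable_sum _ fun i _ =>
        Finset.measurable_sum _ fun j _ => ?_) _
      exact ((continuous_Hm.matrix_elem i j).measurable).comp measurable_fst
    · refine Measurable.const_mul (Finset.measurable_sum _ fun i _ => ?_) _
      exact (measurable_inv_mulVec measurable_fst measurable_const i).const_mul _
    · refine Measurable.const_mul (Finset.measurable_sum _ fun i _ => ?_) _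
      exact ((measurable_pi_apply i).comp measurable_snd).mul
        (measurable_inv_mulVec measurable_fst measurable_snd i)
  · exact (continuous_Hm.matrix_det).measurable.comp measurable_fst

lemma continuous_bF : Continuous (bF P η) := by
  unfold bF; fun_prop

lemma continuous_tF : Continuous fun p : (V → ℝ) × (V → ℝ) => tF P η p.1 p.2 := by
  unfold tF
  refine Continuous.matrix_mulVec (continuous_Hm.comp (continuous_bF.comp continuous_fst)) ?_
  fun_prop

lemma continuous_muD : Continuous (muD P η) := by
  unfold muD
  refine Continuous.mul (Continuous.div_const (Continuous.mul (Continuous.mul ?_ ?_) ?_) _) ?_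
  · refine Real.continuous_exp.comp (continuous_const.mul ?_)
    refine Continuous.dotProduct (by fun_prop) continuous_tF
  · exact (continuous_Hm.comp (continuous_bF.comp continuous_fst)).matrix_det
  · fun_prop
  · fun_prop

/-- The pushforward of the flattened measure is the explicit `(β,θ)` measure. -/
lemma map_mu (h : Good P η) :
    Measure.map (fun p : (V → ℝ) × (V → ℝ) => (bF P η p.1, tF P η p.1 p.2))
      ((volume : Measure ((V → ℝ) × (V → ℝ))).withDensity fun p => ENNReal.ofReal (muD P η p))
    = (volume : Measure ((V → ℝ) × (V → ℝ))).withDensity fun p => ENNReal.ofReal (nuR P η p) := by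
  have hT : Measurable (fun p : (V → ℝ) × (V → ℝ) => (bF P η p.1, tF P η p.1 p.2)) :=
    ((continuous_bF.comp continuous_fst).prodMk continuous_tF).measurable
  refine Measure.ext_of_lintegral _ fun F hF => ?_
  have hnu : Measurable fun p => ENNReal.ofReal (nuR P η p) := (measurable_nuR h).ennreal_ofReal
  have hmu : Measurable fun p => ENNReal.ofReal (muD P η p) :=
    continuous_muD.measurable.ennreal_ofReal
  rw [lintegral_map hF hT]
  change ∫⁻ a, (F ∘ fun p : (V → ℝ) × (V → ℝ) => (bF P η p.1, tF P η p.1 p.2)) a ∂_ = _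
  rw [lintegral_withDensity_eq_lintegral_mul _ hmu (hF.comp hT),
    lintegral_withDensity_eq_lintegral_mul _ hnu hF]
  rw [Measure.volume_eq_prod, lintegral_prod _ (hmu.mul (hF.comp hT)).aemeasurable,
    lintegral_prod _ (hnu.mul hF).aemeasurable]
  set K : (V → ℝ) → ENNReal := fun β => ∫⁻ θ, ENNReal.ofReal (nuR P η (β, θ)) * F (β, θ) with hK
  have inner : ∀ u : V → ℝ, (∫⁻ s, ((fun p => ENNReal.ofReal (muD P η p)) *
      (F ∘ fun p : (V → ℝ) × (V → ℝ) => (bF P η p.1, tF P η p.1 p.2))) (u, s))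
      = ENNReal.ofReal ((1 / 2) ^ Fintype.card V * (Hm P (bF P η u)).det) * K (bF P η u) := by
    intro u
    have hd := (posDef_bF h u).det_pos
    have hE : 0 < ∏ i, Real.exp (u i) := Finset.prod_pos fun i _ => Real.exp_pos _
    set M : Matrix V V ℝ := Hm P (bF P η u) * Matrix.diagonal (fun i => Real.exp (u i)) with hM
    have hMdet : M.det = (Hm P (bF P η u)).det * ∏ i, Real.exp (u i) := by
      rw [hM, Matrix.det_mul, Matrix.det_diagonal]
    have hMpos : 0 < M.det := by rw [hMdet]; positivity
    have htF : ∀ s, tF P η u s = Matrix.toLin' M s := by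
      intro s
      rw [Matrix.toLin'_apply, hM, ← Matrix.mulVec_mulVec, tF]
      congr 1
      funext i
      rw [Matrix.mulVec_diagonal]
    have hmap := Real.map_matrix_volume_pi_eq_smul_volume_pi hMpos.ne'
    have hΦ : Measurable fun θ => ENNReal.ofReal (nuR P η (bF P η u, θ)) * F (bF P η u, θ) :=
      (hnu.mul hF).comp measurable_prodMk_left
    have e : ∀ s, ((fun p => ENNReal.ofReal (muD P η p)) *
      (F ∘ fun p : (V → ℝ) × (V → ℝ) => (bF P η p.1, tF P η p.1 p.2))) (u, s)
      = ENNReal.ofReal (((1 / 2) ^ Fintype.card V * (Hm P (bF P η u)).det) * M.det) *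
        (fun θ => ENNReal.ofReal (nuR P η (bF P η u, θ)) * F (bF P η u, θ))
          (Matrix.toLin' M s) := by
      intro s
      simp only [Pi.mul_apply, Function.comp_apply]
      rw [dens_eq h, ← hMdet, ENNReal.ofReal_mul (by positivity), htF]
      ring
    simp only [e]
    rw [lintegral_const_mul' _ _ ENNReal.ofReal_ne_top,
      ← lintegral_map hΦ (LinearMap.continuous_of_finiteDimensional _).measurable, hmap,
      lintegral_smul_measure, ENNReal.ofReal_mul (by positivity), mul_assoc, hK, smul_eq_mul]
    congr 1
    rw [← mul_assoc, ← ENNReal.ofReal_mul hMpos.le, abs_of_pos (inv_pos.2 hMpos),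
      mul_inv_cancel₀ hMpos.ne', ENNReal.ofReal_one, one_mul]
  simp only [inner]
  have hcv := lintegral_image_eq_lintegral_abs_det_fderiv_mul (volume : Measure (V → ℝ))
    MeasurableSet.univ (fun u _ => (bF_hasFDerivAt h u).hasFDerivWithinAt) (bF_inj h).injOn K
  rw [Set.image_univ, bF_range h, Measure.restrict_univ] at hcv
  have hdet : ∀ u : V → ℝ, |(LinearMap.toContinuousLinearMap (Matrix.toLin' (Matrix.of fun i j =>
      (1 / 2) * (P i j * Real.exp (u j - u i)) - if i = j then bF P η u i else 0))).det|
      = (1 / 2) ^ Fintype.card V * (Hm P (bF P η u)).det := by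
    intro u
    rw [det_bF, abs_mul, abs_pow, abs_neg, abs_of_pos (posDef_bF h u).det_pos]
    norm_num
  simp only [hdet] at hcv
  rw [← hcv, ← lintegral_indicator (measurableSet_posDef h)]
  refine lintegral_congr fun β => ?_
  by_cases hβ : (Hm P β).PosDef
  · rw [Set.indicator_of_mem (by exact hβ)]; rfl
  · rw [Set.indicator_of_notMem (by exact hβ)]
    simp [nuR, hβ]

end CV

/-! ### Integrability -/

/-- The complex vector `G_β (η + i θ)`. -/
def cX {V : Type*} [Fintype V] [DecidableEq V] (P : V → V → ℝ) (η : V → ℝ)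
    (p : (V → ℝ) × (V → ℝ)) (i : V) : ℂ :=
  (((Hm P p.1)⁻¹.mulVec η i : ℝ) : ℂ) + Complex.I * (((Hm P p.1)⁻¹.mulVec p.2 i : ℝ) : ℂ)

section Integ
set_option linter.unusedSectionVars false
variable {V : Type*} [Fintype V] [DecidableEq V] {P : V → V → ℝ} {η : V → ℝ}

/-- The Dirichlet form at `u = 0`. -/
def dir (P : V → V → ℝ) (η : V → ℝ) (s : V → ℝ) : ℝ :=
  (1 / 2) * ∑ i, ∑ j, P i j * (s i - s j) ^ 2 + ∑ i, η i * s i ^ 2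

lemma dir_pos (h : Good P η) {s : V → ℝ} (hs : s ≠ 0) : 0 < dir P η s := by
  have h1 := (posDef_iff h _).1 (posDef_bF h 0) s hs
  have h2 := quad_bF h 0 s
  simp only [Pi.zero_apply, Real.exp_zero, one_mul, add_zero, mul_one] at h2
  unfold dir
  rw [← h2]; exact h1

lemma dir_lower (h : Good P η) : ∃ c > 0, ∀ s : V → ℝ, c * ‖s‖ ^ 2 ≤ dir P η s := by
  have hcont : Continuous (dir P η) := by unfold dir; fun_prop
  have hom : ∀ (a : ℝ) s, dir P η (a • s) = a ^ 2 * dir P η s := by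
    intro a s
    simp only [dir, Pi.smul_apply, smul_eq_mul, mul_add, Finset.mul_sum]
    congr 1
    · refine Finset.sum_congr rfl fun i _ => Finset.sum_congr rfl fun j _ => ?_
      ring
    · refine Finset.sum_congr rfl fun i _ => ?_
      ring
  by_cases hne : (Metric.sphere (0 : V → ℝ) 1).Nonempty
  · obtain ⟨s0, hs0, hmin⟩ := (isCompact_sphere (0 : V → ℝ) 1).exists_isMinOn hne hcont.continuousOn
    have hs0' : s0 ≠ 0 := by
      rintro rfl; simp at hs0
    refine ⟨dir P η s0, dir_pos h hs0', fun s => ?_⟩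
    by_cases hs : s = 0
    · subst hs; simp [dir]
    · have hn : ‖s‖ ≠ 0 := norm_ne_zero_iff.2 hs
      have hmem : ‖s‖⁻¹ • s ∈ Metric.sphere (0 : V → ℝ) 1 := by
        simp [norm_smul, hn]
      have := hmin hmem
      simp only [Set.mem_ofPred_eq] at this
      rw [hom] at this
      have hp : 0 < ‖s‖ ^ 2 := by positivity
      calc dir P η s0 * ‖s‖ ^ 2 ≤ (‖s‖⁻¹ ^ 2 * dir P η s) * ‖s‖ ^ 2 := by gcongr
        _ = dir P η s := by field_simp
  · refine ⟨1, one_pos, fun s => ?_⟩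
    by_cases hs : s = 0
    · subst hs; simp [dir]
    · exfalso; apply hne
      refine ⟨‖s‖⁻¹ • s, ?_⟩
      have hn : ‖s‖ ≠ 0 := norm_ne_zero_iff.2 hs
      simp [norm_smul, hn]

lemma exp_bound (c : ℝ) (hc : 0 < c) (a x : ℝ) : a * x - c * x ^ 2 ≤ a ^ 2 / (4 * c) := by
  rw [le_div_iff₀ (by positivity)]
  nlinarith [sq_nonneg (a - 2 * c * x)]

lemma scalar_bound (c : ℝ) (hc : 0 < c) (M : ℝ) (k r : ℕ) : ∃ C, 0 ≤ C ∧ ∀ a b : ℝ, 0 ≤ a → 0 ≤ b →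
    Real.exp (M * a - c * a ^ 2) * (1 + b) ^ k * Real.exp (- (c * (Real.exp (-2 * a) * b ^ 2)))
      ≤ C * (((1 + a) ^ r)⁻¹ * ((1 + b) ^ r)⁻¹) := by
  refine ⟨Real.exp ((k + r : ℕ) ^ 2 / (4 * c)) * Real.exp ((M + (k + r : ℕ) + r) ^ 2 / (4 * c)),
    by positivity, fun a b ha hb => ?_⟩
  rw [← mul_inv, ← div_eq_mul_inv, le_div_iff₀ (by positivity)]
  set v := Real.exp (-a) * b with hv
  have hv0 : 0 ≤ v := by positivity
  have h1 : (1 + b) ≤ Real.exp a * Real.exp v := by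
    have : b = Real.exp a * v := by rw [hv, ← mul_assoc, ← Real.exp_add]; simp
    have h2 : 1 ≤ Real.exp a := Real.one_le_exp ha
    have h3 := Real.add_one_le_exp v
    calc 1 + b ≤ Real.exp a + Real.exp a * v := by rw [← this]; linarith
      _ = Real.exp a * (v + 1) := by ring
      _ ≤ _ := by gcongr
  have h2 : 1 + a ≤ Real.exp a := by linarith [Real.add_one_le_exp a]
  have h3 : Real.exp (-2 * a) * b ^ 2 = v ^ 2 := by
    rw [hv, mul_pow, ← Real.exp_nat_mul]; congr 2; push_cast; ring
  rw [h3]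
  calc Real.exp (M * a - c * a ^ 2) * (1 + b) ^ k * Real.exp (-(c * v ^ 2))
        * ((1 + a) ^ r * (1 + b) ^ r)
      = (1 + b) ^ (k + r) * (1 + a) ^ r *
        (Real.exp (M * a - c * a ^ 2) * Real.exp (-(c * v ^ 2))) := by rw [pow_add]; ring
    _ ≤ (Real.exp a * Real.exp v) ^ (k + r) * (Real.exp a) ^ r *
        (Real.exp (M * a - c * a ^ 2) * Real.exp (-(c * v ^ 2))) := by gcongr
    _ = Real.exp ((k + r : ℕ) * v - c * v ^ 2)
        * Real.exp ((M + (k + r : ℕ) + r) * a - c * a ^ 2) := by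
      rw [mul_pow, ← Real.exp_nat_mul, ← Real.exp_nat_mul, ← Real.exp_nat_mul]
      simp only [← Real.exp_add]
      congr 1; push_cast; ring
    _ ≤ _ := by
      gcongr
      · exact exp_bound c hc _ v
      · exact exp_bound c hc _ a

lemma le_norm' (u : V → ℝ) (i : V) : |u i| ≤ ‖u‖ := by
  simpa using norm_le_pi_norm u i

lemma cosh_lower (x : ℝ) : x ^ 2 / 2 ≤ Real.cosh x - 1 := by
  have h1 : Real.cosh x = Real.cosh (x / 2) ^ 2 + Real.sinh (x / 2) ^ 2 := by
    rw [← Real.cosh_two_mul]; congr 1; ring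
  have h2 := Real.cosh_sq (x / 2)
  have h3 : (x / 2) ^ 2 ≤ Real.sinh (x / 2) ^ 2 := by
    rcases le_total 0 (x / 2) with h | h
    · exact pow_le_pow_left₀ h (Real.self_le_sinh_iff.2 h) 2
    · have := Real.sinh_le_self_iff.2 h
      nlinarith
  nlinarith

lemma det_bound (h : Good P η) : ∃ C, 0 ≤ C ∧ ∀ u : V → ℝ, (Hm P (bF P η u)).det ≤
    C * Real.exp (2 * Fintype.card V * ‖u‖) := by
  set B : ℝ := ∑ i, ∑ j, P i j + ∑ i, η i with hB
  have hB0 : 0 ≤ B := add_nonneg (Finset.sum_nonneg fun i _ => Finset.sum_nonneg fun j _ =>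
    h.nonneg i j) (Finset.sum_nonneg fun i _ => h.eta i)
  refine ⟨(Fintype.card V).factorial * (2 * B) ^ Fintype.card V, by positivity, fun u => ?_⟩
  have hPij : ∀ i, ∑ j, P i j + η i ≤ B := fun i => by
    have h1 : ∑ j, P i j ≤ ∑ i, ∑ j, P i j :=
      Finset.single_le_sum (f := fun i => ∑ j, P i j)
        (fun i _ => Finset.sum_nonneg fun j _ => h.nonneg i j) (Finset.mem_univ i)
    have h2 : η i ≤ ∑ i, η i := Finset.single_le_sum (fun i _ => h.eta i) (Finset.mem_univ i)
    linarith
  have hP1 : ∀ i j, P i j ≤ B := fun i j => by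
    have h1 : P i j ≤ ∑ j, P i j :=
      Finset.single_le_sum (fun j _ => h.nonneg i j) (Finset.mem_univ j)
    linarith [hPij i, h.eta i]
  have hexp1 : 1 ≤ Real.exp (2 * ‖u‖) := Real.one_le_exp (by positivity)
  have hb : ∀ i, 0 ≤ 2 * bF P η u i ∧ 2 * bF P η u i ≤ B * Real.exp (2 * ‖u‖) := by
    intro i
    have e : 2 * bF P η u i = ∑ j, P i j * Real.exp (u j - u i) + η i * Real.exp (- u i) := by
      simp only [bF]; ring
    rw [e]
    constructor
    · refine add_nonneg (Finset.sum_nonneg fun j _ => mul_nonneg (h.nonneg i j) (Real.exp_pos _).le)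
        (mul_nonneg (h.eta i) (Real.exp_pos _).le)
    · calc ∑ j, P i j * Real.exp (u j - u i) + η i * Real.exp (- u i)
          ≤ ∑ j, P i j * Real.exp (2 * ‖u‖) + η i * Real.exp (2 * ‖u‖) := by
            have hn := norm_nonneg u
            gcongr with j _
            · exact h.nonneg i j
            · have := abs_le.1 (le_norm' u j); have := abs_le.1 (le_norm' u i); linarith
            · exact h.eta i
            · have := abs_le.1 (le_norm' u i); linarith
        _ = (∑ j, P i j + η i) * Real.exp (2 * ‖u‖) := by rw [← Finset.sum_mul]; ring
        _ ≤ _ := by gcongr; exact hPij i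
  have hent : ∀ i j, AbsoluteValue.abs (Hm P (bF P η u) i j) ≤ 2 * B * Real.exp (2 * ‖u‖) := by
    intro i j
    simp only [Hm, Matrix.of_apply, AbsoluteValue.abs_apply]
    have hP' : P i j ≤ B * Real.exp (2 * ‖u‖) :=
      (hP1 i j).trans (le_mul_of_one_le_right hB0 hexp1)
    have := h.nonneg i j
    have := hb i
    rw [abs_le]
    split_ifs
    · constructor <;> linarith
    · constructor <;> linarith
  have := Matrix.det_le hent
  rw [AbsoluteValue.abs_apply, nsmul_eq_mul] at this
  refine (le_abs_self _).trans (this.trans (le_of_eq ?_))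
  rw [mul_pow, ← Real.exp_nat_mul]
  rw [mul_assoc]
  congr 3
  ring

lemma integrable_mu (h : Good P η) {k : ℕ} (j : Fin k → V) :
    Integrable (fun p : (V → ℝ) × (V → ℝ) =>
      (∏ l, ((Real.exp (p.1 (j l)) : ℂ) * (1 + Complex.I * (p.2 (j l) : ℂ))))
        * (muD P η p : ℂ)) volume := by
  obtain ⟨c, hc, hdir⟩ := dir_lower h
  obtain ⟨C1, hC1, hdet⟩ := det_bound h
  set n := Fintype.card V with hn
  set M : ℝ := k + 2 * n + n with hM
  obtain ⟨C2, hC2, hsc⟩ := scalar_bound (c / 2) (by positivity) M k (n + 1)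
  have hpi := Real.pi_pos
  set g : (V → ℝ) → ℝ := fun u => ((1 + ‖u‖) ^ (n + 1))⁻¹ with hg
  have hgi : Integrable g volume := by
    have := integrable_one_add_norm (E := V → ℝ) (μ := volume) (r := (n + 1 : ℕ)) (by simp [hn])
    refine this.congr (Filter.Eventually.of_forall fun x => ?_)
    simp only [hg]
    rw [Real.rpow_neg (by positivity), Real.rpow_natCast]
  have hdom : Integrable (fun p : (V → ℝ) × (V → ℝ) => C1 / (2 * Real.pi) ^ n * C2 * (g p.1 * g p.2))
      volume := by
    rw [Measure.volume_eq_prod]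
    exact (hgi.mul_prod hgi).const_mul _
  refine hdom.mono' ?_ (Filter.Eventually.of_forall fun p => ?_)
  · refine Continuous.aestronglyMeasurable (Continuous.mul ?_
      (Complex.continuous_ofReal.comp continuous_muD))
    fun_prop
  obtain ⟨u, s⟩ := p
  have hnn := norm_nonneg u
  have hns := norm_nonneg s
  rw [norm_mul, norm_prod, Complex.norm_real, Real.norm_of_nonneg (muD_nonneg h _)]
  have hX : ∏ l, ‖((Real.exp (u (j l)) : ℂ) * (1 + Complex.I * (s (j l) : ℂ)))‖
      ≤ Real.exp (k * ‖u‖) * (1 + ‖s‖) ^ k := by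
    calc ∏ l, ‖((Real.exp (u (j l)) : ℂ) * (1 + Complex.I * (s (j l) : ℂ)))‖
        ≤ ∏ l : Fin k, (Real.exp ‖u‖ * (1 + ‖s‖)) := by
          refine Finset.prod_le_prod (fun l _ => norm_nonneg _) fun l _ => ?_
          rw [norm_mul, Complex.norm_real, Real.norm_of_nonneg (Real.exp_pos _).le]
          gcongr
          · exact (abs_le.1 (le_norm' u _)).2
          · refine (norm_add_le _ _).trans ?_
            rw [norm_one, norm_mul, Complex.norm_I, one_mul, Complex.norm_real]
            gcongr
            exact le_norm' s _
      _ = _ := by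
          rw [Finset.prod_const, Finset.card_univ, Fintype.card_fin, mul_pow, ← Real.exp_nat_mul]
  have hQ : Real.exp (-(2 * ‖u‖)) * (c * ‖s‖ ^ 2) ≤
      (fun i => Real.exp (u i) * s i) ⬝ᵥ tF P η u s := by
    unfold tF
    rw [quad_bF h]
    refine (mul_le_mul_of_nonneg_left (hdir s) (Real.exp_pos _).le).trans ?_
    unfold dir
    rw [mul_add, mul_left_comm, Finset.mul_sum, Finset.mul_sum]
    simp only [Finset.mul_sum]
    refine add_le_add ?_ (Finset.sum_le_sum fun i _ => ?_)
    · refine Finset.sum_le_sum fun i _ => Finset.sum_le_sum fun i' _ => ?_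
      have h1 := h.nonneg i i'
      have h2 := abs_le.1 (le_norm' u i)
      have h3 := abs_le.1 (le_norm' u i')
      have h4 : Real.exp (-(2 * ‖u‖)) ≤ Real.exp (u i + u i') := Real.exp_le_exp.2 (by linarith)
      have h5 : 0 ≤ P i i' * (s i - s i') ^ 2 := by positivity
      nlinarith [mul_le_mul_of_nonneg_left h4 h5]
    · have h1 := h.eta i
      have h2 := abs_le.1 (le_norm' u i)
      have h4 : Real.exp (-(2 * ‖u‖)) ≤ Real.exp (u i) := Real.exp_le_exp.2 (by linarith)
      have h5 : 0 ≤ η i * s i ^ 2 := by positivity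
      nlinarith [mul_le_mul_of_nonneg_left h4 h5]
  have hcosh : c / 2 * ‖u‖ ^ 2 ≤ (1 / 2) * (∑ i, ∑ j, P i j * (Real.cosh (u i - u j) - 1))
        + ∑ i, η i * (Real.cosh (u i) - 1) := by
    have h1 := hdir u
    have h2 : dir P η u / 2 ≤ (1 / 2) * (∑ i, ∑ j, P i j * (Real.cosh (u i - u j) - 1))
        + ∑ i, η i * (Real.cosh (u i) - 1) := by
      have e : dir P η u / 2 = (1 / 2) * (∑ i, ∑ j, P i j * ((u i - u j) ^ 2 / 2))
        + ∑ i, η i * ((u i) ^ 2 / 2) := by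
        simp only [dir, ← mul_div_assoc, ← Finset.sum_div]; ring
      rw [e]
      gcongr with i _ j _ i _
      · exact h.nonneg _ _
      · exact cosh_lower _
      · exact h.eta _
      · exact cosh_lower _
    linarith
  have hprod : ∏ i, Real.exp (u i) ≤ Real.exp (n * ‖u‖) := by
    rw [← Real.exp_sum]
    gcongr
    calc ∑ i, u i ≤ ∑ _i : V, ‖u‖ := Finset.sum_le_sum fun i _ => (abs_le.1 (le_norm' u i)).2
      _ = n * ‖u‖ := by simp [hn]
  have hdp := (posDef_bF h u).det_pos
  have hmu : muD P η (u, s) ≤ Real.exp (-(c / 2 * (Real.exp (-2 * ‖u‖) * ‖s‖ ^ 2))) *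
      (C1 * Real.exp (2 * n * ‖u‖)) * Real.exp (n * ‖u‖) / (2 * Real.pi) ^ n
      * Real.exp (-(c / 2 * ‖u‖ ^ 2)) := by
    unfold muD
    simp only
    gcongr
    · rw [show -2 * ‖u‖ = -(2 * ‖u‖) by ring]; linarith
    · exact hdet u
  calc _ ≤ (Real.exp (k * ‖u‖) * (1 + ‖s‖) ^ k) *
      (Real.exp (-(c / 2 * (Real.exp (-2 * ‖u‖) * ‖s‖ ^ 2))) *
      (C1 * Real.exp (2 * n * ‖u‖)) * Real.exp (n * ‖u‖) / (2 * Real.pi) ^ n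
      * Real.exp (-(c / 2 * ‖u‖ ^ 2))) := by
        refine mul_le_mul hX hmu (muD_nonneg h _) (by positivity)
    _ = C1 / (2 * Real.pi) ^ n * (Real.exp (M * ‖u‖ - c / 2 * ‖u‖ ^ 2) * (1 + ‖s‖) ^ k
        * Real.exp (-(c / 2 * (Real.exp (-2 * ‖u‖) * ‖s‖ ^ 2)))) := by
      have : Real.exp (M * ‖u‖ - c / 2 * ‖u‖ ^ 2) = Real.exp (k * ‖u‖) * Real.exp (2 * n * ‖u‖)
        * Real.exp (n * ‖u‖) * Real.exp (-(c / 2 * ‖u‖ ^ 2)) := by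
        simp only [← Real.exp_add]; congr 1; rw [hM]; ring
      rw [this]; ring
    _ ≤ C1 / (2 * Real.pi) ^ n * (C2 * (((1 + ‖u‖) ^ (n + 1))⁻¹ * ((1 + ‖s‖) ^ (n + 1))⁻¹)) := by
      exact mul_le_mul_of_nonneg_left (hsc _ _ hnn hns) (by positivity)
    _ = _ := by simp only [hg]; ring

lemma cX_bF (h : Good P η) (u s : V → ℝ) (i : V) :
    cX P η (bF P η u, tF P η u s) i = (Real.exp (u i) : ℂ) * (1 + Complex.I * (s i : ℂ)) := by
  unfold cX
  simp only
  rw [inv_eta_bF h, inv_theta h]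
  push_cast; ring

lemma measurable_cX (i : V) : Measurable fun p => cX P η p i := by
  unfold cX
  refine Measurable.add ?_ (Measurable.const_mul ?_ _)
  · exact Complex.measurable_ofReal.comp (measurable_inv_mulVec measurable_fst measurable_const i)
  · exact Complex.measurable_ofReal.comp (measurable_inv_mulVec measurable_fst measurable_snd i)

lemma measurable_T : Measurable (fun p : (V → ℝ) × (V → ℝ) => (bF P η p.1, tF P η p.1 p.2)) :=
  ((continuous_bF.comp continuous_fst).prodMk continuous_tF).measurable

/-- Transfer of integrals from `(u,s)` to `(β,θ)`. -/
lemma integral_mu_eq (h : Good P η) {k : ℕ} (j : Fin k → V) (g : (V → ℝ) × (V → ℝ) → ℂ)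
    (hg : Measurable g) :
    ∫ p : (V → ℝ) × (V → ℝ),
      (∏ l, ((Real.exp (p.1 (j l)) : ℂ) * (1 + Complex.I * (p.2 (j l) : ℂ))))
        * g (bF P η p.1, tF P η p.1 p.2)
        ∂(volume.withDensity fun p => ENNReal.ofReal (muD P η p))
    = ∫ p : (V → ℝ) × (V → ℝ), nuR P η p • ((∏ l, cX P η p (j l)) * g p) := by
  have e : ∀ p : (V → ℝ) × (V → ℝ),
      (∏ l, ((Real.exp (p.1 (j l)) : ℂ) * (1 + Complex.I * (p.2 (j l) : ℂ))))
        * g (bF P η p.1, tF P η p.1 p.2)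
      = (fun q => (∏ l, cX P η q (j l)) * g q) (bF P η p.1, tF P η p.1 p.2) := fun p => by
    simp only [cX_bF h]
  simp only [e]
  have hm : Measurable fun q => (∏ l, cX P η q (j l)) * g q :=
    (Finset.measurable_prod _ fun l _ => measurable_cX _).mul hg
  rw [← integral_map measurable_T.aemeasurable hm.aestronglyMeasurable, map_mu h]
  rw [integral_withDensity_eq_integral_toReal_smul (measurable_nuR h).ennreal_ofReal
    (Filter.Eventually.of_forall fun _ => ENNReal.ofReal_lt_top)]
  refine integral_congr_ae (Filter.Eventually.of_forall fun p => ?_)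
  simp only [ENNReal.toReal_ofReal (nuR_nonneg p)]

lemma integrable_nu (h : Good P η) {k : ℕ} (j : Fin k → V) (g : (V → ℝ) × (V → ℝ) → ℂ)
    (hg : Measurable g) (hgbd : ∃ C : ℝ, ∀ x, ‖g x‖ ≤ C) :
    Integrable (fun p : (V → ℝ) × (V → ℝ) => nuR P η p • ((∏ l, cX P η p (j l)) * g p)) := by
  have hm : Measurable fun q => (∏ l, cX P η q (j l)) :=
    (Finset.measurable_prod _ fun l _ => measurable_cX _)
  have h1 : Integrable (fun p : (V → ℝ) × (V → ℝ) => nuR P η p • (∏ l, cX P η p (j l))) := by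
    have h2 : Integrable (fun q => (∏ l, cX P η q (j l)))
        ((volume : Measure ((V → ℝ) × (V → ℝ))).withDensity
          fun p => ENNReal.ofReal (nuR P η p)) := by
      rw [← map_mu h, integrable_map_measure hm.aestronglyMeasurable measurable_T.aemeasurable,
        integrable_withDensity_iff_integrable_smul' continuous_muD.measurable.ennreal_ofReal
        (Filter.Eventually.of_forall fun _ => ENNReal.ofReal_lt_top)]
      refine (integrable_mu h j).congr (Filter.Eventually.of_forall fun p => ?_)
      simp only [Function.comp_apply, cX_bF h, ENNReal.toReal_ofReal (muD_nonneg h p)]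
      rw [Complex.real_smul, mul_comm]
    rw [integrable_withDensity_iff_integrable_smul' (measurable_nuR h).ennreal_ofReal
        (Filter.Eventually.of_forall fun _ => ENNReal.ofReal_lt_top)] at h2
    refine h2.congr (Filter.Eventually.of_forall fun p => ?_)
    simp only [ENNReal.toReal_ofReal (nuR_nonneg p)]
  obtain ⟨C, hC⟩ := hgbd
  have h3 := h1.mul_bdd hg.aestronglyMeasurable (Filter.Eventually.of_forall hC)
  refine h3.congr (Filter.Eventually.of_forall fun p => ?_)
  simp only [smul_mul_assoc]

end Integ

/-! ### The one-vertex identity -/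

lemma gig_integral (a : ℝ) (ha : 0 < a) :
    ∫ τ in Set.Ioi (0 : ℝ), τ ^ (-(1 / 2) : ℝ) * Real.exp (- τ / 2 - a ^ 2 / (2 * τ))
      = Real.sqrt (2 * Real.pi) * Real.exp (-a) := by
  set R : ℝ → ℝ := fun v => Real.sqrt (v ^ 2 + 4 * a) with hR
  have hRpos : ∀ v, 0 < R v := fun v => Real.sqrt_pos.2 (by positivity)
  have hRsq : ∀ v, R v ^ 2 = v ^ 2 + 4 * a := fun v => Real.sq_sqrt (by positivity)
  set t : ℝ → ℝ := fun v => (v + R v) / 2 with ht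
  have htpos : ∀ v, 0 < t v := fun v => by
    have h1 : |v| < R v := by
      rw [← Real.sqrt_sq_eq_abs]; exact Real.sqrt_lt_sqrt (sq_nonneg _) (by linarith)
    have := neg_abs_le v
    simp only [ht]; linarith
  have htv : ∀ v, t v ^ 2 = v * t v + a := fun v => by
    simp only [ht]; nlinarith [hRsq v]
  have hRd : ∀ v, HasDerivAt R (v / R v) v := fun v => by
    have h1 : HasDerivAt (fun v : ℝ => v ^ 2 + 4 * a) (2 * v) v := by
      simpa using (hasDerivAt_pow 2 v).add_const (4 * a)
    have h2 := h1.sqrt (by positivity)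
    convert h2 using 1
    simp only [hR]
    field_simp
  have htd : ∀ v, HasDerivAt t ((1 + v / R v) / 2) v := fun v =>
    ((hasDerivAt_id v).add (hRd v)).div_const 2
  have hfd : ∀ v, HasDerivAt (fun v => t v ^ 2) (t v * (1 + v / R v)) v := fun v => by
    have := (htd v).mul (htd v)
    have e1 : (fun v => t v ^ 2) = t * t := by funext x; simp [sq]
    rw [e1]
    exact this.congr_deriv (by ring)
  have hinj : Function.Injective (fun v => t v ^ 2) := by
    intro v v' hvv
    have h1 : t v = t v' := by
      have := hvv
      simp only at this
      exact (pow_left_inj₀ (htpos v).le (htpos v').le two_ne_zero).1 this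
    have h2 := htv v
    have h3 := htv v'
    rw [h1] at h2
    have : (v - v') * t v' = 0 := by linarith
    rcases mul_eq_zero.1 this with h | h
    · linarith
    · exact absurd h (htpos v').ne'
  have himg : (fun v => t v ^ 2) '' Set.univ = Set.Ioi 0 := by
    ext τ
    constructor
    · rintro ⟨v, -, rfl⟩; exact pow_pos (htpos v) 2
    · intro hτ
      have hτ : 0 < τ := hτ
      have hs : 0 < Real.sqrt τ := Real.sqrt_pos.2 hτ
      have hs2 : Real.sqrt τ ^ 2 = τ := Real.sq_sqrt hτ.le
      refine ⟨Real.sqrt τ - a / Real.sqrt τ, trivial, ?_⟩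
      have hRv : R (Real.sqrt τ - a / Real.sqrt τ) = Real.sqrt τ + a / Real.sqrt τ := by
        simp only [hR]
        rw [show (Real.sqrt τ - a / Real.sqrt τ) ^ 2 + 4 * a
          = (Real.sqrt τ + a / Real.sqrt τ) ^ 2 by field_simp; ring]
        exact Real.sqrt_sq (by positivity)
      simp only [ht]
      rw [hRv]
      rw [show (Real.sqrt τ - a / Real.sqrt τ + (Real.sqrt τ + a / Real.sqrt τ)) / 2
        = Real.sqrt τ by ring, hs2]
  have hcv := integral_image_eq_integral_abs_deriv_smul MeasurableSet.univ
    (fun v _ => (hfd v).hasDerivWithinAt) hinj.injOn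
    (fun τ : ℝ => τ ^ (-(1 / 2) : ℝ) * Real.exp (- τ / 2 - a ^ 2 / (2 * τ)))
  rw [himg] at hcv
  rw [hcv, Measure.restrict_univ]
  have habs : ∀ v, |v / R v| ≤ 1 := fun v => by
    rw [abs_div, abs_of_pos (hRpos v), div_le_one (hRpos v), ← Real.sqrt_sq_eq_abs]
    exact Real.sqrt_le_sqrt (by linarith)
  have e : ∀ v, |t v * (1 + v / R v)| • ((t v ^ 2) ^ (-(1 / 2) : ℝ) *
      Real.exp (- (t v ^ 2) / 2 - a ^ 2 / (2 * t v ^ 2)))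
      = Real.exp (-a) * (Real.exp (-(1 / 2) * v ^ 2) + v / R v * Real.exp (-(1 / 2) * v ^ 2)) := by
    intro v
    have h1 : 0 ≤ 1 + v / R v := by have := (abs_le.1 (habs v)).1; linarith
    rw [abs_of_nonneg (mul_nonneg (htpos v).le h1)]
    have h2 : (t v ^ 2) ^ (-(1 / 2) : ℝ) = (t v)⁻¹ := by
      rw [Real.rpow_neg (by positivity), ← Real.sqrt_eq_rpow, Real.sqrt_sq (htpos v).le]
    have h3 : - (t v ^ 2) / 2 - a ^ 2 / (2 * t v ^ 2) = -a + -(1 / 2) * v ^ 2 := by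
      have hv : v = t v - a / t v := by
        have := htv v
        have := (htpos v).ne'
        field_simp; linarith
      have hne := (htpos v).ne'
      have : v ^ 2 = (t v - a / t v) ^ 2 := by rw [← hv]
      rw [this]; field_simp; ring
    rw [h2, h3, Real.exp_add, smul_eq_mul]
    have := (htpos v).ne'
    field_simp
  simp only [e]
  have i1 : Integrable fun v : ℝ => Real.exp (-(1 / 2) * v ^ 2) :=
    integrable_exp_neg_mul_sq (by norm_num)
  have hRc : Continuous fun v => v / R v :=
    continuous_id.div (by simp only [hR]; fun_prop) fun v => (hRpos v).ne'
  have i2 : Integrable fun v : ℝ => v / R v * Real.exp (-(1 / 2) * v ^ 2) :=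
    i1.bdd_mul hRc.aestronglyMeasurable (Filter.Eventually.of_forall fun v => by
      rw [Real.norm_eq_abs]; exact habs v)
  rw [integral_const_mul, integral_add i1 i2, integral_gaussian]
  have hodd : ∫ v : ℝ, v / R v * Real.exp (-(1 / 2) * v ^ 2) = 0 := by
    have h1 := integral_neg_eq_self (fun v : ℝ => v / R v * Real.exp (-(1 / 2) * v ^ 2)) volume
    have h2 : ∀ v : ℝ, -v / R (-v) * Real.exp (-(1 / 2) * (-v) ^ 2)
      = -(v / R v * Real.exp (-(1 / 2) * v ^ 2)) := fun v => by
      have : R (-v) = R v := by simp [hR]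
      rw [this, neg_sq]; ring
    simp only [h2] at h1
    rw [integral_neg] at h1
    linarith
  rw [hodd, add_zero, mul_comm]
  congr 2
  ring

open Classical in
/-- One-vertex density in `(τ, θ)`. -/
def w1 (η : ℝ) (τ θ : ℝ) : ℝ :=
  if 0 < τ then Real.exp (- τ / 2 + η - (η ^ 2 + θ ^ 2) / (2 * τ)) / (2 * Real.pi * τ) else 0

/-- One-vertex complex variable. -/
def zz (η : ℝ) (τ θ : ℝ) : ℂ := ((η : ℂ) + Complex.I * (θ : ℂ)) / (τ : ℂ)

lemma w1_nonneg (η τ θ : ℝ) : 0 ≤ w1 η τ θ := by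
  unfold w1
  have := Real.pi_pos
  split_ifs
  · positivity
  · exact le_rfl

lemma measurable_w1 (η : ℝ) : Measurable fun p : ℝ × ℝ => w1 η p.1 p.2 := by
  unfold w1
  refine Measurable.ite (measurableSet_lt measurable_const measurable_fst) ?_ measurable_const
  fun_prop

lemma measurable_zz (η : ℝ) : Measurable fun p : ℝ × ℝ => zz η p.1 p.2 := by
  unfold zz
  fun_prop

lemma norm_zz (η τ θ : ℝ) (hτ : 0 < τ) : ‖zz η τ θ‖ = Real.sqrt (η ^ 2 + θ ^ 2) / τ := by
  unfold zz
  rw [norm_div, Complex.norm_real, Real.norm_of_nonneg hτ.le, mul_comm Complex.I,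
    Complex.norm_add_mul_I]

open Classical in
lemma integrable_dom (C : ℝ) : Integrable (fun p : ℝ × ℝ =>
    if 0 < p.1 then C * Real.exp (- p.1 / 2) * Real.exp (-(1 / (4 * p.1)) * p.2 ^ 2) / (2 * Real.pi * p.1)
      else 0) := by
  have hpi := Real.pi_pos
  have hm : Measurable (fun p : ℝ × ℝ =>
    if 0 < p.1 then C * Real.exp (- p.1 / 2) * Real.exp (-(1 / (4 * p.1)) * p.2 ^ 2) / (2 * Real.pi * p.1)
      else 0) := by
    refine Measurable.ite (measurableSet_lt measurable_const measurable_fst) ?_ measurable_const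
    fun_prop
  rw [Measure.volume_eq_prod, integrable_prod_iff hm.aestronglyMeasurable]
  constructor
  · refine Filter.Eventually.of_forall fun τ => ?_
    by_cases hτ : 0 < τ
    · simp only [hτ, if_true]
      exact ((integrable_exp_neg_mul_sq (by positivity)).const_mul _).div_const _
    · simp [hτ]
  · have hI : IntegrableOn (fun τ : ℝ => τ ^ (-(1 / 2) : ℝ) * Real.exp (-(1 / 2) * τ ^ (1 : ℝ)))
        (Set.Ioi 0) := integrableOn_rpow_mul_exp_neg_mul_rpow (by norm_num) (by norm_num) (by norm_num)
    have hI2 := (integrable_indicator_iff measurableSet_Ioi).2 (hI.const_mul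
      (|C| * Real.sqrt (4 * Real.pi) / (2 * Real.pi)))
    refine hI2.congr (Filter.Eventually.of_forall fun τ => ?_)
    by_cases hτ : 0 < τ
    · rw [Set.indicator_of_mem (by exact hτ)]
      simp only [hτ, if_true, norm_div, norm_mul, Real.norm_eq_abs, Real.abs_exp]
      rw [integral_div, integral_const_mul, integral_gaussian]
      rw [abs_of_pos hτ, abs_of_pos hpi, abs_two]
      have h1 : Real.pi / (1 / (4 * τ)) = (4 * Real.pi) * τ := by field_simp
      rw [h1, Real.sqrt_mul (by positivity) τ, Real.rpow_one, Real.rpow_neg hτ.le,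
        ← Real.sqrt_eq_rpow]
      have h2 : Real.sqrt τ * Real.sqrt τ = τ := Real.mul_self_sqrt hτ.le
      have hs : 0 < Real.sqrt τ := Real.sqrt_pos.2 hτ
      rw [show -(1 / 2 : ℝ) * τ = -τ / 2 by ring]
      rw [div_mul_eq_mul_div, div_eq_div_iff (by positivity) (by positivity)]
      field_simp
      rw [Real.sq_sqrt hτ.le]
    · rw [Set.indicator_of_notMem (by exact hτ)]
      simp [hτ]

lemma integrable_exp_w1 (η : ℝ) (hη : 0 < η) (lam : ℝ) (hl : |lam| ≤ η / 4) :
    Integrable (fun p : ℝ × ℝ => Real.exp (|lam| * ‖zz η p.1 p.2‖) * w1 η p.1 p.2) := by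
  refine (integrable_dom (Real.exp η)).mono' ?_ (Filter.Eventually.of_forall fun p => ?_)
  · exact (Real.measurable_exp.comp ((measurable_zz η).norm.const_mul _)).mul (measurable_w1 η)
      |>.aestronglyMeasurable
  obtain ⟨τ, θ⟩ := p
  have hpi := Real.pi_pos
  by_cases hτ : 0 < τ
  · simp only [w1, hτ, if_true]
    rw [Real.norm_of_nonneg (by positivity), norm_zz _ _ _ hτ, ← mul_div_assoc]
    refine div_le_div_of_nonneg_right ?_ (by positivity)
    rw [← Real.exp_add, ← Real.exp_add, ← Real.exp_add]
    refine Real.exp_le_exp.2 ?_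
    set r := Real.sqrt (η ^ 2 + θ ^ 2) with hr
    have hr2 : r ^ 2 = η ^ 2 + θ ^ 2 := Real.sq_sqrt (by positivity)
    have hrη : η ≤ r := Real.le_sqrt_of_sq_le (by nlinarith [sq_nonneg θ])
    have h1 : |lam| * r ≤ r ^ 2 / 4 := by nlinarith [abs_nonneg lam]
    have h2 : |lam| * (r / τ) ≤ r ^ 2 / 4 / τ := by
      rw [← mul_div_assoc]; gcongr
    have h3 : r ^ 2 / 4 / τ - (η ^ 2 + θ ^ 2) / (2 * τ) ≤ -(1 / (4 * τ)) * θ ^ 2 := by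
      have : -(1 / (4 * τ)) * θ ^ 2 - (r ^ 2 / 4 / τ - (η ^ 2 + θ ^ 2) / (2 * τ)) = η ^ 2 / (4 * τ) := by
        rw [hr2]; field_simp; ring
      have : 0 ≤ η ^ 2 / (4 * τ) := by positivity
      linarith
    linarith
  · simp [w1, hτ]

lemma gen_w1 (η : ℝ) (hη : 0 < η) (lam : ℝ) (hl : |lam| ≤ η / 4) :
    ∫ p : ℝ × ℝ, Complex.exp (lam * zz η p.1 p.2) * (w1 η p.1 p.2 : ℂ) = Complex.exp lam := by
  have hpi := Real.pi_pos
  have hint : Integrable (fun p : ℝ × ℝ =>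
      Complex.exp (lam * zz η p.1 p.2) * (w1 η p.1 p.2 : ℂ)) := by
    refine (integrable_exp_w1 η hη lam hl).mono' ?_ (Filter.Eventually.of_forall fun p => ?_)
    · exact ((Complex.measurable_exp.comp ((measurable_zz η).const_mul _)).mul
        (Complex.measurable_ofReal.comp (measurable_w1 η))).aestronglyMeasurable
    · rw [norm_mul, Complex.norm_real, Real.norm_of_nonneg (w1_nonneg _ _ _), Complex.norm_exp]
      gcongr
      · exact w1_nonneg _ _ _
      · refine (Complex.re_le_norm _).trans ?_
        rw [norm_mul, Complex.norm_real, Real.norm_eq_abs]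
  rw [Measure.volume_eq_prod] at hint ⊢
  rw [integral_prod _ hint]
  have inner : ∀ τ : ℝ, (∫ θ : ℝ, Complex.exp (lam * zz η τ θ) * (w1 η τ θ : ℂ))
      = (Set.Ioi (0 : ℝ)).indicator (fun τ => ((Real.exp η / Real.sqrt (2 * Real.pi) *
        (τ ^ (-(1 / 2) : ℝ) * Real.exp (- τ / 2 - (η - lam) ^ 2 / (2 * τ))) : ℝ) : ℂ)) τ := by
    intro τ
    by_cases hτ : 0 < τ
    · rw [Set.indicator_of_mem (by exact hτ)]
      have hτc : (τ : ℂ) ≠ 0 := by exact_mod_cast hτ.ne'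
      have hpc : (Real.pi : ℂ) ≠ 0 := by exact_mod_cast hpi.ne'
      have e : ∀ θ : ℝ, Complex.exp (lam * zz η τ θ) * (w1 η τ θ : ℂ)
          = (1 / (2 * Real.pi * τ) : ℂ) * Complex.exp ((-(1 / (2 * τ)) : ℂ) * θ ^ 2
            + (Complex.I * lam / τ) * θ + (lam * η / τ - τ / 2 + η - η ^ 2 / (2 * τ))) := by
        intro θ
        simp only [w1, hτ, if_true, zz]
        push_cast
        rw [mul_div_assoc', ← Complex.exp_add, div_eq_mul_one_div, mul_comm]
        congr 2
        field_simp
        ring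
      simp only [e]
      have hb : ((-(1 / (2 * τ)) : ℂ)).re < 0 := by
        have : ((-(1 / (2 * τ)) : ℂ)) = ((-(1 / (2 * τ)) : ℝ) : ℂ) := by push_cast; ring
        rw [this, Complex.ofReal_re]
        have : 0 < 1 / (2 * τ) := by positivity
        linarith
      rw [integral_const_mul, integral_cexp_quadratic hb]
      have h1 : ((Real.pi : ℂ) / -(-(1 / (2 * τ)) : ℂ)) ^ (1 / 2 : ℂ)
          = ((Real.sqrt (2 * Real.pi * τ) : ℝ) : ℂ) := by
        rw [Real.sqrt_eq_rpow, Complex.ofReal_cpow (by positivity)]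
        congr 1
        · push_cast; field_simp
        · push_cast; ring
      have h2 : ((lam * η / τ - τ / 2 + η - η ^ 2 / (2 * τ)) : ℂ)
          - (Complex.I * lam / τ) ^ 2 / (4 * (-(1 / (2 * τ)) : ℂ))
          = ((η + (- τ / 2 - (η - lam) ^ 2 / (2 * τ)) : ℝ) : ℂ) := by
        push_cast
        rw [div_pow, mul_pow, Complex.I_sq]
        field_simp
        ring
      rw [h1, h2, ← Complex.ofReal_exp]
      rw [Real.exp_add]
      have h3 : 1 / (2 * Real.pi * τ) * Real.sqrt (2 * Real.pi * τ)
          = 1 / Real.sqrt (2 * Real.pi) * τ ^ (-(1 / 2) : ℝ) := by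
        rw [Real.rpow_neg hτ.le, ← Real.sqrt_eq_rpow, Real.sqrt_mul (by positivity) τ]
        have hs : 0 < Real.sqrt τ := Real.sqrt_pos.2 hτ
        have hs' : 0 < Real.sqrt (2 * Real.pi) := Real.sqrt_pos.2 (by positivity)
        have h4 : Real.sqrt τ ^ 2 = τ := Real.sq_sqrt hτ.le
        have h5 : Real.sqrt (2 * Real.pi) ^ 2 = 2 * Real.pi := Real.sq_sqrt (by positivity)
        rw [div_mul_eq_mul_div, one_mul, ← div_eq_mul_inv, div_div, div_eq_div_iff (by positivity) (by positivity)]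
        calc _ = Real.sqrt (2 * Real.pi) ^ 2 * Real.sqrt τ ^ 2 := by ring
          _ = _ := by rw [h4, h5]; ring
      have h3' : (1 / (2 * Real.pi * τ) : ℂ) * ((Real.sqrt (2 * Real.pi * τ) : ℝ) : ℂ)
          = ((1 / Real.sqrt (2 * Real.pi) * τ ^ (-(1 / 2) : ℝ) : ℝ) : ℂ) := by
        rw [← h3]; push_cast; ring
      rw [← mul_assoc, h3', ← Complex.ofReal_mul]
      congr 1
      ring
    · rw [Set.indicator_of_notMem (by exact hτ)]
      simp [w1, hτ]
  simp only [inner]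
  rw [integral_indicator measurableSet_Ioi, integral_complex_ofReal, integral_const_mul,
    gig_integral (η - lam) (by have := (abs_le.1 hl).2; linarith), ← Complex.ofReal_exp]
  congr 1
  have hs' : Real.sqrt (2 * Real.pi) ≠ 0 := (Real.sqrt_pos.2 (by positivity)).ne'
  have : Real.exp lam = Real.exp η * Real.exp (-(η - lam)) := by
    rw [← Real.exp_add]; congr 1; ring
  rw [this]
  field_simp

lemma integrable_pow_w1 (η : ℝ) (hη : 0 < η) (k : ℕ) :
    Integrable (fun p : ℝ × ℝ => zz η p.1 p.2 ^ k * (w1 η p.1 p.2 : ℂ)) := by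
  have hη4 : 0 < η / 4 := by positivity
  have h0 := (integrable_exp_w1 η hη (η / 4) (by rw [abs_of_pos hη4])).const_mul
    ((k.factorial : ℝ) / (η / 4) ^ k)
  refine h0.mono' ?_ (Filter.Eventually.of_forall fun p => ?_)
  · exact (((measurable_zz η).pow_const _).mul
        (Complex.measurable_ofReal.comp (measurable_w1 η))).aestronglyMeasurable
  · rw [norm_mul, Complex.norm_real, Real.norm_of_nonneg (w1_nonneg _ _ _), norm_pow,
      abs_of_pos hη4, ← mul_assoc]
    refine mul_le_mul_of_nonneg_right ?_ (w1_nonneg _ _ _)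
    have := Real.pow_div_factorial_le_exp (x := η / 4 * ‖zz η p.1 p.2‖) (by positivity) k
    rw [div_mul_eq_mul_div, le_div_iff₀ (by positivity)]
    rw [div_le_iff₀ (by positivity)] at this
    rw [mul_pow] at this
    linarith

lemma moment_w1 (η : ℝ) (hη : 0 < η) (k : ℕ) :
    ∫ p : ℝ × ℝ, zz η p.1 p.2 ^ k * (w1 η p.1 p.2 : ℂ) = 1 := by
  set a : ℕ → ℂ := fun k => ∫ p : ℝ × ℝ, zz η p.1 p.2 ^ k * (w1 η p.1 p.2 : ℂ) with ha
  have hsum : ∀ lam : ℝ, |lam| ≤ η / 4 →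
      HasSum (fun k : ℕ => lam ^ k • ((a k) / (k.factorial : ℂ))) (Complex.exp lam) := by
    intro lam hl
    rw [← gen_w1 η hη lam hl]
    have := hasSum_integral_of_dominated_convergence (μ := (volume : Measure (ℝ × ℝ)))
      (F := fun (k : ℕ) (p : ℝ × ℝ) => ((lam : ℂ) * zz η p.1 p.2) ^ k / (k.factorial : ℂ)
        * (w1 η p.1 p.2 : ℂ))
      (f := fun p => Complex.exp (lam * zz η p.1 p.2) * (w1 η p.1 p.2 : ℂ))
      (fun k p => (|lam| * ‖zz η p.1 p.2‖) ^ k / (k.factorial : ℝ) * w1 η p.1 p.2)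
      (fun k => ?_) (fun k => Filter.Eventually.of_forall fun p => ?_)
      (Filter.Eventually.of_forall fun p => ?_) ?_ (Filter.Eventually.of_forall fun p => ?_)
    · have e1 : (fun k : ℕ => lam ^ k • ((a k) / (k.factorial : ℂ))) = fun k : ℕ =>
          ∫ p : ℝ × ℝ, ((lam : ℂ) * zz η p.1 p.2) ^ k / (k.factorial : ℂ) * (w1 η p.1 p.2 : ℂ) := by
        funext k
        show lam ^ k • ((∫ p : ℝ × ℝ, zz η p.1 p.2 ^ k * (w1 η p.1 p.2 : ℂ)) / (k.factorial : ℂ)) = _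
        rw [Complex.real_smul, ← mul_div_assoc, ← integral_const_mul, ← integral_div]
        congr 1
        funext p
        push_cast
        rw [mul_pow]; ring
      rw [e1]; exact this
    · exact (((((measurable_zz η).const_mul _).pow_const _).div_const _).mul
        (Complex.measurable_ofReal.comp (measurable_w1 η))).aestronglyMeasurable
    · rw [norm_mul, norm_div, norm_pow, norm_mul, Complex.norm_real, Complex.norm_real,
        Real.norm_of_nonneg (w1_nonneg _ _ _), Real.norm_eq_abs, Complex.norm_natCast]
    · exact (Real.summable_pow_div_factorial _).mul_right _
    · refine (integrable_exp_w1 η hη lam hl).congr (Filter.Eventually.of_forall fun p => ?_)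
      simp only
      rw [tsum_mul_right, Real.exp_eq_exp_ℝ, NormedSpace.exp_eq_tsum_div]
    · refine HasSum.mul_right _ ?_
      rw [Complex.exp_eq_exp_ℂ]
      exact NormedSpace.expSeries_div_hasSum_exp _
  have hsum2 : ∀ lam : ℝ, |lam| ≤ η / 4 →
      HasSum (fun k : ℕ => lam ^ k • ((a k - 1) / (k.factorial : ℂ))) 0 := by
    intro lam hl
    have h1 : HasSum (fun k : ℕ => lam ^ k • (1 / (k.factorial : ℂ))) (Complex.exp lam) := by
      rw [Complex.exp_eq_exp_ℂ]
      have e1 : (fun k : ℕ => lam ^ k • (1 / (k.factorial : ℂ)))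
          = fun k : ℕ => (lam : ℂ) ^ k / (k.factorial : ℂ) := by
        funext k; rw [Complex.real_smul]; push_cast; ring
      rw [e1]; exact NormedSpace.expSeries_div_hasSum_exp (lam : ℂ)
    have h2 := (hsum lam hl).sub h1
    rw [sub_self] at h2
    have e1 : (fun k : ℕ => lam ^ k • ((a k - 1) / (k.factorial : ℂ))) = fun k : ℕ =>
        lam ^ k • ((a k) / (k.factorial : ℂ)) - lam ^ k • (1 / (k.factorial : ℂ)) := by
      funext k; rw [← smul_sub, sub_div]
    rw [e1]; exact h2
  set p : FormalMultilinearSeries ℝ ℝ ℂ := fun n =>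
    ContinuousMultilinearMap.mkPiRing ℝ (Fin n) ((a n - 1) / (n.factorial : ℂ)) with hp
  have hcoeff : ∀ n, p.coeff n = (a n - 1) / (n.factorial : ℂ) := fun n => by
    simp [FormalMultilinearSeries.coeff, hp]
  have hps : HasFPowerSeriesAt (0 : ℝ → ℂ) p 0 := by
    rw [hasFPowerSeriesAt_iff]
    have : ∀ᶠ z : ℝ in nhds 0, |z| < η / 4 := by
      have := Metric.ball_mem_nhds (0 : ℝ) (show 0 < η / 4 by positivity)
      filter_upwards [this] with z hz
      simpa using hz
    filter_upwards [this] with z hz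
    simp only [hcoeff]
    exact hsum2 z hz.le
  have h0 := hps.eq_zero
  have hk := hcoeff k
  rw [h0] at hk
  have hk' : (a k - 1) / (k.factorial : ℂ) = 0 := by
    rw [← hk]; simp [FormalMultilinearSeries.coeff]
  have hf : (k.factorial : ℂ) ≠ 0 := by exact_mod_cast k.factorial_ne_zero
  rw [div_eq_zero_iff] at hk'
  rcases hk' with h | h
  · exact sub_eq_zero.1 h
  · exact absurd h hf

lemma one_vertex (η : ℝ) (hη : 0 < η) {k : ℕ} (c d : Fin k → ℂ) :
    ∫ τ : ℝ, ∫ θ : ℝ, (∏ l, (c l + d l * zz η τ θ)) * (w1 η τ θ : ℂ) = ∏ l, (c l + d l) := by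
  set q : Polynomial ℂ := ∏ l, (Polynomial.C (c l) + Polynomial.C (d l) * Polynomial.X) with hq
  have he : ∀ z : ℂ, ∏ l, (c l + d l * z) = q.eval z := fun z => by
    simp [hq, Polynomial.eval_prod]
  have he1 : ∏ l, (c l + d l) = q.eval 1 := by rw [← he]; simp
  have e : ∀ τ θ, (∏ l, (c l + d l * zz η τ θ)) * (w1 η τ θ : ℂ)
      = ∑ i ∈ Finset.range (q.natDegree + 1), q.coeff i * (zz η τ θ ^ i * (w1 η τ θ : ℂ)) := by
    intro τ θ
    rw [he, Polynomial.eval_eq_sum_range, Finset.sum_mul]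
    exact Finset.sum_congr rfl fun i _ => by ring
  have hi : ∀ i, Integrable (fun p : ℝ × ℝ =>
      q.coeff i * (zz η p.1 p.2 ^ i * (w1 η p.1 p.2 : ℂ))) := fun i =>
    (integrable_pow_w1 η hη i).const_mul _
  have hint : Integrable (fun p : ℝ × ℝ => ∑ i ∈ Finset.range (q.natDegree + 1),
      q.coeff i * (zz η p.1 p.2 ^ i * (w1 η p.1 p.2 : ℂ))) :=
    integrable_finsetSum _ fun i _ => hi i
  simp only [e]
  have h1 : ∫ p : ℝ × ℝ, (∑ i ∈ Finset.range (q.natDegree + 1),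
      q.coeff i * (zz η p.1 p.2 ^ i * (w1 η p.1 p.2 : ℂ))) = q.eval 1 := by
    rw [integral_finsetSum _ fun i _ => hi i, Polynomial.eval_eq_sum_range]
    refine Finset.sum_congr rfl fun i _ => ?_
    rw [integral_const_mul, moment_w1 η hη, one_pow]
  rw [he1, ← h1]
  rw [Measure.volume_eq_prod] at hint ⊢
  exact (integral_prod _ hint).symm

/-! ### Elimination of one vertex: linear algebra -/

/-- Vector on `Option A` from its restriction to `A` and its value at `none`. -/
def opt {A : Type*} (x : A → ℝ) (t : ℝ) : Option A → ℝ := fun o => o.elim t x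

section Elim
set_option linter.unusedSectionVars false
variable {A : Type*} [Fintype A] [DecidableEq A] {P : Option A → Option A → ℝ} {η : Option A → ℝ}

/-- Restricted weights. -/
def resP {A : Type*} (P : Option A → Option A → ℝ) : A → A → ℝ := fun a b => P (some a) (some b)

/-- Weights to the eliminated vertex. -/
def resw {A : Type*} (P : Option A → Option A → ℝ) : A → ℝ := fun a => P (some a) none

/-- New pinning after elimination. -/
def resE {A : Type*} (P : Option A → Option A → ℝ) (η : Option A → ℝ) : A → ℝ :=
  fun a => η (some a) + P (some a) none

lemma opt_eta {A : Type*} (x : Option A → ℝ) : opt (fun a => x (some a)) (x none) = x := by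
  funext o; cases o <;> rfl

lemma opt_dot (x v : A → ℝ) (y z : ℝ) : opt x y ⬝ᵥ opt v z = x ⬝ᵥ v + y * z := by
  simp [dotProduct, Fintype.sum_option, opt, add_comm]

lemma opt_mulVec (h : Good P η) (β x : A → ℝ) (t y : ℝ) :
    (Hm P (opt β t)).mulVec (opt x y)
      = opt ((Hm (resP P) β).mulVec x - y • resw P) (2 * t * y - resw P ⬝ᵥ x) := by
  funext o
  rw [Hm_mulVec]
  cases o with
  | none =>
    have e : ∀ a, P none (some a) = P (some a) none := fun a => h.symm _ _
    simp [Fintype.sum_option, opt, h.diag, dotProduct, resw, e]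
  | some a =>
    simp only [opt, Fintype.sum_option, Option.elim, Pi.sub_apply, Hm_mulVec, resP, resw,
      Pi.smul_apply, smul_eq_mul]
    ring

lemma opt_quad (h : Good P η) (β x : A → ℝ) (t y : ℝ) :
    opt x y ⬝ᵥ (Hm P (opt β t)).mulVec (opt x y)
      = x ⬝ᵥ (Hm (resP P) β).mulVec x - 2 * y * (resw P ⬝ᵥ x) + 2 * t * y ^ 2 := by
  rw [opt_mulVec h, opt_dot, dotProduct_sub, dotProduct_smul, dotProduct_comm x (resw P), smul_eq_mul]
  ring

lemma good_res (h : Good P η) : Good (resP P) (resE P η) where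
  symm i j := h.symm _ _
  diag i := h.diag _
  nonneg i j := h.nonneg _ _
  eta i := add_nonneg (h.eta _) (h.nonneg _ _)
  conn S hS := by
    obtain ⟨o, ho, ho'⟩ := h.conn (some '' S) (hS.image _)
    obtain ⟨a, ha, rfl⟩ := ho
    refine ⟨a, ha, ?_⟩
    rcases ho' with h1 | ⟨j, hj, h1⟩
    · left; exact add_pos_of_pos_of_nonneg h1 (h.nonneg _ _)
    · cases j with
      | none => left; exact add_pos_of_nonneg_of_pos (h.eta _) h1
      | some b => right; exact ⟨b, fun hb => hj ⟨b, hb, rfl⟩, h1⟩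

lemma Hm_symm_dot (h : Good P η) {β : A → ℝ} (x y : A → ℝ) :
    x ⬝ᵥ (Hm (resP P) β).mulVec y = y ⬝ᵥ (Hm (resP P) β).mulVec x := by
  have h1 : (Hm (resP P) β).transpose = Hm (resP P) β := by
    have := Hm_herm (good_res h) β
    rwa [Matrix.IsHermitian, Matrix.conjTranspose_eq_transpose_of_trivial] at this
  rw [Matrix.dotProduct_mulVec, ← Matrix.mulVec_transpose, h1, dotProduct_comm]

lemma inv_symm_dot (h : Good P η) {β : A → ℝ} (hp : (Hm (resP P) β).PosDef) (x y : A → ℝ) :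
    x ⬝ᵥ (Hm (resP P) β)⁻¹.mulVec y = y ⬝ᵥ (Hm (resP P) β)⁻¹.mulVec x := by
  have := Hm_symm_dot h (β := β) ((Hm (resP P) β)⁻¹.mulVec x) ((Hm (resP P) β)⁻¹.mulVec y)
  rw [mulVec_inv hp, mulVec_inv hp] at this
  rw [dotProduct_comm x, dotProduct_comm y, this]

/-- `q = w · G w`. -/
def qq (P : Option A → Option A → ℝ) (β : A → ℝ) (v : A → ℝ) : ℝ :=
  resw P ⬝ᵥ (Hm (resP P) β)⁻¹.mulVec v

lemma opt_posDef (h : Good P η) (β : A → ℝ) (t : ℝ) :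
    (Hm P (opt β t)).PosDef ↔ (Hm (resP P) β).PosDef ∧ 0 < 2 * t - qq P β (resw P) := by
  rw [posDef_iff h]
  constructor
  · intro H
    have hp : (Hm (resP P) β).PosDef := by
      rw [posDef_iff (good_res h)]
      intro x hx
      have := H (opt x 0) (fun h0 => hx (by
        funext a; exact congrFun h0 (some a)))
      rw [opt_quad h] at this
      simpa using this
    refine ⟨hp, ?_⟩
    have := H (opt ((Hm (resP P) β)⁻¹.mulVec (resw P)) 1) (fun h0 => by
      have := congrFun h0 none; simp [opt] at this)
    rw [opt_quad h, mulVec_inv hp, dotProduct_comm _ (resw P)] at this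
    simp only [qq]; linarith
  · rintro ⟨hp, hτ⟩ z hz
    rw [← opt_eta z] at hz ⊢
    set x : A → ℝ := fun a => z (some a)
    set y := z none
    set G := (Hm (resP P) β)⁻¹.mulVec (resw P) with hG
    have key : opt x y ⬝ᵥ (Hm P (opt β t)).mulVec (opt x y)
        = (x - y • G) ⬝ᵥ (Hm (resP P) β).mulVec (x - y • G) + (2 * t - qq P β (resw P)) * y ^ 2 := by
      rw [opt_quad h, Matrix.mulVec_sub, Matrix.mulVec_smul, hG, mulVec_inv hp, ← hG]
      simp only [sub_dotProduct, dotProduct_sub, smul_dotProduct, dotProduct_smul, smul_eq_mul]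
      rw [Hm_symm_dot h G x, hG, mulVec_inv hp, ← hG, dotProduct_comm x (resw P),
        dotProduct_comm G (resw P)]
      simp only [qq, ← hG]
      ring
    rw [key]
    by_cases hy : y = 0
    · have hx : x ≠ 0 := fun hx => hz (by
        rw [hx, hy]; funext o; cases o <;> rfl)
      have := (posDef_iff (good_res h) β).1 hp x hx
      simpa [hy] using this
    · have h1 : 0 ≤ (x - y • G) ⬝ᵥ (Hm (resP P) β).mulVec (x - y • G) := by
        by_cases hx : x - y • G = 0
        · simp [hx]
        · exact ((posDef_iff (good_res h) β).1 hp _ hx).le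
      have h2 : 0 < (2 * t - qq P β (resw P)) * y ^ 2 := by positivity
      linarith

lemma opt_inv (h : Good P η) {β : A → ℝ} {t : ℝ} (hp : (Hm (resP P) β).PosDef)
    (hτ : 0 < 2 * t - qq P β (resw P)) (v : A → ℝ) (z : ℝ) :
    (Hm P (opt β t))⁻¹.mulVec (opt v z)
      = opt ((Hm (resP P) β)⁻¹.mulVec v +
          ((z + qq P β v) / (2 * t - qq P β (resw P))) • (Hm (resP P) β)⁻¹.mulVec (resw P))
        ((z + qq P β v) / (2 * t - qq P β (resw P))) := by
  refine inv_mulVec_eq ((opt_posDef h β t).2 ⟨hp, hτ⟩) ?_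
  rw [opt_mulVec h]
  congr 1
  · rw [Matrix.mulVec_add, Matrix.mulVec_smul, mulVec_inv hp, mulVec_inv hp]
    simp
  · rw [dotProduct_add, dotProduct_smul, smul_eq_mul]
    change _ - (qq P β v + _ * qq P β (resw P)) = _
    field_simp
    ring

lemma opt_inv_quad (h : Good P η) {β : A → ℝ} {t : ℝ} (hp : (Hm (resP P) β).PosDef)
    (hτ : 0 < 2 * t - qq P β (resw P)) (v : A → ℝ) (z : ℝ) :
    opt v z ⬝ᵥ (Hm P (opt β t))⁻¹.mulVec (opt v z)
      = v ⬝ᵥ (Hm (resP P) β)⁻¹.mulVec v + (z + qq P β v) ^ 2 / (2 * t - qq P β (resw P)) := by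
  rw [opt_inv h hp hτ, opt_dot, dotProduct_add, dotProduct_smul, smul_eq_mul,
    inv_symm_dot h hp v (resw P)]
  change _ + _ * qq P β v + _ = _
  field_simp
  ring

lemma opt_det (h : Good P η) {β : A → ℝ} {t : ℝ} (hp : (Hm (resP P) β).PosDef) :
    (Hm P (opt β t)).det = (Hm (resP P) β).det * (2 * t - qq P β (resw P)) := by
  have e : (Hm P (opt β t)).submatrix (Equiv.optionEquivSumPUnit.{0} A).symm
      (Equiv.optionEquivSumPUnit.{0} A).symm
      = Matrix.fromBlocks (Hm (resP P) β) (Matrix.of fun a _ => - resw P a)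
        (Matrix.of fun _ a => - resw P a) (Matrix.of fun _ _ => 2 * t) := by
    ext i j
    rcases i with i | i <;> rcases j with j | j
    · simp [Hm, opt, resP]
    · simp [Hm, opt, resw]
    · simp [Hm, opt, resw, h.symm none (some j)]
    · simp [Hm, opt, h.diag]
  rw [← Matrix.det_submatrix_equiv_self (Equiv.optionEquivSumPUnit.{0} A).symm, e]
  have : Invertible (Hm (resP P) β) := Matrix.invertibleOfIsUnitDet _ (Hm_isUnit hp)
  rw [Matrix.det_fromBlocks₁₁, Matrix.invOf_eq_nonsing_inv]
  congr 1
  rw [Matrix.det_unique]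
  simp only [Matrix.sub_apply, Matrix.of_apply, Matrix.mul_apply, qq, dotProduct, Matrix.mulVec]
  congr 1
  simp only [Finset.sum_mul, Finset.mul_sum]
  rw [Finset.sum_comm]
  refine Finset.sum_congr rfl fun a _ => Finset.sum_congr rfl fun b _ => ?_
  ring

lemma opt_sum (h : Good P η) (β : A → ℝ) (t : ℝ) :
    ∑ i, ∑ j, Hm P (opt β t) i j = (∑ i, ∑ j, Hm (resP P) β i j) - 2 * ∑ i, resw P i + 2 * t := by
  have e : ∀ a b, Hm P (opt β t) (some a) (some b) = Hm (resP P) β a b := by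
    intro a b; simp [Hm, opt, resP]
  have e1 : ∀ a, Hm P (opt β t) (some a) none = - resw P a := by
    intro a; simp [Hm, opt, resw]
  have e2 : ∀ a, Hm P (opt β t) none (some a) = - resw P a := by
    intro a; simp [Hm, opt, resw, h.symm none (some a)]
  have e3 : Hm P (opt β t) none none = 2 * t := by simp [Hm, opt, h.diag]
  simp only [Fintype.sum_option, e, e1, e2, e3, Finset.sum_add_distrib, Finset.sum_neg_distrib]
  ring

/-- Effective pinning of the eliminated vertex. -/
def etil (P : Option A → Option A → ℝ) (η : Option A → ℝ) (β : A → ℝ) : ℝ :=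
  η none + qq P β (fun a => η (some a))

lemma etil_pos (h : Good P η) {β : A → ℝ} (hp : (Hm (resP P) β).PosDef) : 0 < etil P η β := by
  set t := (qq P β (resw P) + 1) / 2 with ht
  have hτ : 2 * t - qq P β (resw P) = 1 := by rw [ht]; ring
  have hτ' : 0 < 2 * t - qq P β (resw P) := by rw [hτ]; exact one_pos
  have h1 := inv_eta_pos h ((opt_posDef h β t).2 ⟨hp, hτ'⟩) none
  rw [← opt_eta η, opt_inv h hp hτ', hτ, div_one] at h1
  exact h1

lemma qq_add (β v v' : A → ℝ) : qq P β (v + v') = qq P β v + qq P β v' := by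
  simp [qq, Matrix.mulVec_add, dotProduct_add]

lemma nuR_opt (h : Good P η) {β : A → ℝ} (hp : (Hm (resP P) β).PosDef) (θ : A → ℝ) (t s : ℝ) :
    nuR P η (opt β t, opt θ s) = nuR (resP P) (resE P η) (β, θ) *
      (2 * w1 (etil P η β) (2 * t - qq P β (resw P)) (s + qq P β θ)) := by
  have hpi := Real.pi_pos
  unfold w1
  by_cases hτ : 0 < 2 * t - qq P β (resw P)
  · have hp2 := (opt_posDef h β t).2 ⟨hp, hτ⟩
    have hd := hp.det_pos
    rw [if_pos hτ]
    unfold nuR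
    simp only
    rw [if_pos hp2, if_pos hp, opt_sum h, opt_det h hp, opt_inv_quad h hp hτ]
    have e1 := opt_inv_quad h hp hτ (fun a => η (some a)) (η none)
    rw [opt_eta] at e1
    rw [e1]
    have e2 : resE P η = (fun a => η (some a)) + resw P := rfl
    have e3 : ∑ i, resE P η i = ∑ a, η (some a) + ∑ a, resw P a := by
      simp only [e2, Pi.add_apply, Finset.sum_add_distrib]
    have e4 : resE P η ⬝ᵥ (Hm (resP P) β)⁻¹.mulVec (resE P η)
        = (fun a => η (some a)) ⬝ᵥ (Hm (resP P) β)⁻¹.mulVec (fun a => η (some a))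
          + 2 * qq P β (fun a => η (some a)) + qq P β (resw P) := by
      rw [e2, Matrix.mulVec_add, add_dotProduct, dotProduct_add, dotProduct_add,
        inv_symm_dot h hp _ (resw P)]
      simp only [qq]; ring
    rw [e3, e4, Fintype.sum_option, Fintype.card_option, pow_succ]
    set τ := 2 * t - qq P β (resw P) with hτd
    have ht : 2 * t = τ + qq P β (resw P) := by rw [hτd]; ring
    rw [ht]
    simp only [etil]
    set D := (Hm (resP P) β).det
    rw [show ∀ E1 E2 : ℝ, E1 / D / Real.pi ^ Fintype.card A * (2 * (E2 / (2 * Real.pi * τ)))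
      = (E1 * E2) / (D * τ) / (Real.pi ^ Fintype.card A * Real.pi) by
        intro E1 E2; field_simp, ← Real.exp_add]
    congr 4
    field_simp
    ring
  · rw [if_neg hτ]
    unfold nuR
    rw [if_neg (fun hh => hτ ((opt_posDef h β t).1 hh).2)]
    simp

lemma cX_opt (h : Good P η) {β : A → ℝ} (hp : (Hm (resP P) β).PosDef) (θ : A → ℝ) {t : ℝ} (s : ℝ)
    (hτ : 0 < 2 * t - qq P β (resw P)) (a : A) :
    cX P η (opt β t, opt θ s) (some a) =
      cX (resP P) (fun a => η (some a)) (β, θ) a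
      + (((Hm (resP P) β)⁻¹.mulVec (resw P) a : ℝ) : ℂ)
        * zz (etil P η β) (2 * t - qq P β (resw P)) (s + qq P β θ) := by
  unfold cX
  simp only
  have e1 := opt_inv h hp hτ (fun a => η (some a)) (η none)
  rw [opt_eta] at e1
  rw [e1, opt_inv h hp hτ]
  simp only [opt, Option.elim, Pi.add_apply, Pi.smul_apply, smul_eq_mul, zz, etil]
  push_cast
  ring

lemma cX_res (β θ : A → ℝ) (a : A) :
    cX (resP P) (fun a => η (some a)) (β, θ) a + (((Hm (resP P) β)⁻¹.mulVec (resw P) a : ℝ) : ℂ)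
      = cX (resP P) (resE P η) (β, θ) a := by
  have e2 : resE P η = (fun a => η (some a)) + resw P := rfl
  unfold cX
  simp only
  rw [e2, Matrix.mulVec_add]
  simp only [Pi.add_apply]
  push_cast
  ring

end Elim

/-! ### Elimination of one vertex: integration -/

section ElimInt
set_option linter.unusedSectionVars false
variable {A : Type*} [Fintype A] [DecidableEq A] {P : Option A → Option A → ℝ} {η : Option A → ℝ}

lemma mp_assoc (X Y Z : Type*) [MeasureSpace X] [MeasureSpace Y] [MeasureSpace Z]
    [SFinite (volume : Measure X)] [SFinite (volume : Measure Y)] [SFinite (volume : Measure Z)] :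
    MeasurePreserving (MeasurableEquiv.prodAssoc : (X × Y) × Z ≃ᵐ X × Y × Z) volume volume :=
  ⟨MeasurableEquiv.prodAssoc.measurable, Measure.prodAssoc_prod⟩

lemma mp_shuffle (X Y Z T : Type*) [MeasureSpace X] [MeasureSpace Y] [MeasureSpace Z]
    [MeasureSpace T]
    [SigmaFinite (volume : Measure X)] [SigmaFinite (volume : Measure Y)]
    [SigmaFinite (volume : Measure Z)] [SigmaFinite (volume : Measure T)] :
    MeasurePreserving (fun p : (X × Y) × (Z × T) => ((p.1.1, p.2.1), (p.1.2, p.2.2)))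
      volume volume := by
  have h1 := mp_assoc X Y (Z × T)
  have h2 := (MeasurePreserving.id (volume : Measure X)).prod (mp_assoc Y Z T).symm
  have h3 := (MeasurePreserving.id (volume : Measure X)).prod
    ((Measure.measurePreserving_swap (μ := (volume : Measure Y)) (ν := (volume : Measure Z))).prod
      (MeasurePreserving.id (volume : Measure T)))
  have h4 := (MeasurePreserving.id (volume : Measure X)).prod (mp_assoc Z Y T)
  have h5 := (mp_assoc X Z (Y × T)).symm
  exact h5.comp (h4.comp (h3.comp (h2.comp h1)))

lemma mp_opt : MeasurePreserving (fun p : (A → ℝ) × ℝ => opt p.1 p.2) volume volume := by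
  have hm : Measurable (fun p : (A → ℝ) × ℝ => opt p.1 p.2) := by
    refine measurable_pi_lambda _ fun o => ?_
    cases o with
    | none => exact measurable_snd
    | some a => exact (measurable_pi_apply a).comp measurable_fst
  refine ⟨hm, ?_⟩
  symm
  refine Measure.pi_eq fun s hs => ?_
  rw [Measure.map_apply hm (MeasurableSet.univ_pi hs)]
  have e : (fun p : (A → ℝ) × ℝ => opt p.1 p.2) ⁻¹' (Set.univ.pi s)
      = (Set.univ.pi fun a => s (some a)) ×ˢ s none := by
    ext p
    simp only [Set.mem_preimage, Set.mem_pi, Set.mem_univ, true_imp_iff, Set.mem_prod]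
    constructor
    · intro H; exact ⟨fun a => H (some a), H none⟩
    · rintro ⟨H1, H2⟩ o
      cases o with
      | none => exact H2
      | some a => exact H1 a
  rw [e, Measure.volume_eq_prod, Measure.prod_prod, volume_pi_pi, Fintype.prod_option, mul_comm]

/-- The reordering of coordinates. -/
def optE (p : ((A → ℝ) × (A → ℝ)) × (ℝ × ℝ)) : (Option A → ℝ) × (Option A → ℝ) :=
  (opt p.1.1 p.2.1, opt p.1.2 p.2.2)

lemma mp_optE : MeasurePreserving (optE (A := A)) volume volume :=
  (mp_opt.prod mp_opt).comp (mp_shuffle (A → ℝ) (A → ℝ) ℝ ℝ)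

lemma emb_optE : MeasurableEmbedding (optE (A := A)) := by
  let e : (((A → ℝ) × (A → ℝ)) × (ℝ × ℝ)) ≃ᵐ ((Option A → ℝ) × (Option A → ℝ)) :=
    { toFun := optE
      invFun := fun p => ((fun a => p.1 (some a), fun a => p.2 (some a)), (p.1 none, p.2 none))
      left_inv := fun p => rfl
      right_inv := fun p => by
        refine Prod.ext ?_ ?_
        · exact opt_eta p.1
        · exact opt_eta p.2
      measurable_toFun := mp_optE.measurable
      measurable_invFun := by
        change Measurable fun p : (Option A → ℝ) × (Option A → ℝ) =>
          (((fun a => p.1 (some a), fun a => p.2 (some a)), (p.1 none, p.2 none)) :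
            ((A → ℝ) × (A → ℝ)) × (ℝ × ℝ))
        fun_prop }
  exact e.measurableEmbedding

lemma scale_integral (φ : ℝ → ℂ) (q : ℝ) : ∫ t : ℝ, φ (2 * t - q) = (1 / 2 : ℝ) • ∫ τ, φ τ := by
  have h1 := Measure.integral_comp_mul_left (fun y => φ (y - q)) 2
  rw [h1, integral_sub_right_eq_self φ q]
  congr 1
  rw [abs_of_pos] <;> norm_num

lemma step_opt (h : Good P η) {k : ℕ} (j : Fin k → A) (g : (A → ℝ) × (A → ℝ) → ℂ)
    (hg : Measurable g) (hgbd : ∃ C : ℝ, ∀ x, ‖g x‖ ≤ C) :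
    ∫ p : (Option A → ℝ) × (Option A → ℝ), nuR P η p • ((∏ l, cX P η p (some (j l)))
        * g (fun a => p.1 (some a), fun a => p.2 (some a)))
    = ∫ p : (A → ℝ) × (A → ℝ), nuR (resP P) (resE P η) p •
        ((∏ l, cX (resP P) (resE P η) p (j l)) * g p) := by
  have hint := integrable_nu h (fun l => some (j l))
    (fun p => g (fun a => p.1 (some a), fun a => p.2 (some a)))
    (hg.comp (by fun_prop)) (by obtain ⟨C, hC⟩ := hgbd; exact ⟨C, fun x => hC _⟩)
  rw [← mp_optE.integral_comp emb_optE]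
  rw [← mp_optE.integrable_comp_emb emb_optE] at hint
  simp only [Function.comp_def] at hint
  rw [Measure.volume_eq_prod] at hint ⊢
  rw [integral_prod _ hint]
  refine integral_congr_ae ?_
  filter_upwards [hint.prod_right_ae] with x hx
  obtain ⟨β, θ⟩ := x
  rw [Measure.volume_eq_prod] at hx ⊢
  rw [integral_prod _ hx]
  by_cases hp : (Hm (resP P) β).PosDef
  · have e : ∀ t s : ℝ, nuR P η (optE ((β, θ), (t, s))) •
        ((∏ l, cX P η (optE ((β, θ), (t, s))) (some (j l))) *
          g (fun a => (optE ((β, θ), (t, s))).1 (some a), fun a => (optE ((β, θ), (t, s))).2 (some a)))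
        = (2 * (nuR (resP P) (resE P η) (β, θ) : ℂ) * g (β, θ)) *
          ((∏ l, (cX (resP P) (fun a => η (some a)) (β, θ) (j l)
            + (((Hm (resP P) β)⁻¹.mulVec (resw P) (j l) : ℝ) : ℂ)
            * zz (etil P η β) (2 * t - qq P β (resw P)) (s + qq P β θ))) *
            (w1 (etil P η β) (2 * t - qq P β (resw P)) (s + qq P β θ) : ℂ)) := by
      intro t s
      change nuR P η (opt β t, opt θ s) • ((∏ l, cX P η (opt β t, opt θ s) (some (j l))) * g (β, θ)) = _
      rw [nuR_opt h hp]
      by_cases hτ : 0 < 2 * t - qq P β (resw P)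
      · simp only [cX_opt h hp θ s hτ]
        rw [Complex.real_smul]
        push_cast
        ring
      · simp [w1, hτ]
    simp only [Function.comp_def, e]
    simp only [integral_const_mul]
    have e2 : ∀ t : ℝ, ∫ s : ℝ, ((∏ l, (cX (resP P) (fun a => η (some a)) (β, θ) (j l)
            + (((Hm (resP P) β)⁻¹.mulVec (resw P) (j l) : ℝ) : ℂ)
            * zz (etil P η β) (2 * t - qq P β (resw P)) (s + qq P β θ))) *
            (w1 (etil P η β) (2 * t - qq P β (resw P)) (s + qq P β θ) : ℂ))
        = ∫ s : ℝ, ((∏ l, (cX (resP P) (fun a => η (some a)) (β, θ) (j l)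
            + (((Hm (resP P) β)⁻¹.mulVec (resw P) (j l) : ℝ) : ℂ)
            * zz (etil P η β) (2 * t - qq P β (resw P)) s)) *
            (w1 (etil P η β) (2 * t - qq P β (resw P)) s : ℂ)) := fun t =>
      integral_add_right_eq_self (fun s => ((∏ l, (cX (resP P) (fun a => η (some a)) (β, θ) (j l)
            + (((Hm (resP P) β)⁻¹.mulVec (resw P) (j l) : ℝ) : ℂ)
            * zz (etil P η β) (2 * t - qq P β (resw P)) s)) *
            (w1 (etil P η β) (2 * t - qq P β (resw P)) s : ℂ))) (qq P β θ)
    simp only [e2]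
    rw [scale_integral (fun τ => ∫ s : ℝ, ((∏ l, (cX (resP P) (fun a => η (some a)) (β, θ) (j l)
            + (((Hm (resP P) β)⁻¹.mulVec (resw P) (j l) : ℝ) : ℂ)
            * zz (etil P η β) τ s)) * (w1 (etil P η β) τ s : ℂ))), one_vertex _ (etil_pos h hp)]
    simp only [cX_res]
    rw [Complex.real_smul, Complex.real_smul]
    push_cast
    ring
  · have e1 : nuR (resP P) (resE P η) (β, θ) = 0 := by
      unfold nuR; rw [if_neg hp]
    have e2 : ∀ t s, nuR P η (optE ((β, θ), (t, s))) = 0 := fun t s => by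
      unfold nuR optE
      rw [if_neg (fun hh => hp ((opt_posDef h β t).1 hh).1)]
    simp [Function.comp_def, e1, e2]

end ElimInt

/-! ### Relabelling -/

section Relabel
set_option linter.unusedSectionVars false
variable {V V' : Type*} [Fintype V] [DecidableEq V] [Fintype V'] [DecidableEq V']

lemma good_equiv {P : V → V → ℝ} {η : V → ℝ} (h : Good P η) (e : V' ≃ V) :
    Good (fun i j => P (e i) (e j)) (fun i => η (e i)) where
  symm i j := h.symm _ _
  diag i := h.diag _
  nonneg i j := h.nonneg _ _
  eta i := h.eta _
  conn S hS := by
    obtain ⟨o, ⟨a, ha, rfl⟩, ho'⟩ := h.conn (e '' S) (hS.image _)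
    refine ⟨a, ha, ?_⟩
    rcases ho' with h1 | ⟨j, hj, h1⟩
    · left; exact h1
    · right
      refine ⟨e.symm j, fun hb => hj ⟨_, hb, by simp⟩, by simpa using h1⟩

variable {P : V → V → ℝ} {η : V → ℝ}

lemma Hm_equiv (e : V' ≃ V) (β : V → ℝ) :
    Hm (fun i j => P (e i) (e j)) (fun i => β (e i)) = (Hm P β).submatrix e e := by
  ext i j
  simp [Hm, e.injective.eq_iff]

lemma inv_equiv (e : V' ≃ V) (β v : V → ℝ) :
    (Hm (fun i j => P (e i) (e j)) (fun i => β (e i)))⁻¹.mulVec (fun i => v (e i))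
      = fun i => (Hm P β)⁻¹.mulVec v (e i) := by
  rw [Hm_equiv, Matrix.inv_submatrix_equiv, Matrix.submatrix_mulVec_equiv]
  funext i
  simp only [Function.comp_apply]
  congr 2
  funext j
  simp

lemma posDef_equiv (e : V' ≃ V) (β : V → ℝ) :
    (Hm (fun i j => P (e i) (e j)) (fun i => β (e i))).PosDef ↔ (Hm P β).PosDef := by
  rw [Hm_equiv]
  constructor
  · intro hh
    have := hh.submatrix e.symm.injective
    simpa using this
  · intro hh; exact hh.submatrix e.injective

lemma nuR_equiv (e : V' ≃ V) (p : (V → ℝ) × (V → ℝ)) :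
    nuR (fun i j => P (e i) (e j)) (fun i => η (e i)) (fun i => p.1 (e i), fun i => p.2 (e i))
      = nuR P η p := by
  unfold nuR
  simp only
  by_cases hp : (Hm P p.1).PosDef
  · rw [if_pos ((posDef_equiv e _).2 hp), if_pos hp, inv_equiv, inv_equiv]
    have e1 : (Hm (fun i j => P (e i) (e j)) (fun i => p.1 (e i))).det = (Hm P p.1).det := by
      rw [Hm_equiv, Matrix.det_submatrix_equiv_self]
    have e2 : ∑ i, ∑ j, Hm (fun i j => P (e i) (e j)) (fun i => p.1 (e i)) i j
        = ∑ i, ∑ j, Hm P p.1 i j := by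
      rw [Hm_equiv]
      rw [← e.sum_comp (fun i => ∑ j, Hm P p.1 i j)]
      refine Finset.sum_congr rfl fun i _ => ?_
      exact e.sum_comp (fun j => Hm P p.1 (e i) j)
    have e3 : ∀ v w : V → ℝ, (fun i => v (e i)) ⬝ᵥ (fun i => w (e i)) = v ⬝ᵥ w := fun v w =>
      e.sum_comp (fun i => v i * w i)
    rw [e1, e2, e3, e3, e.sum_comp η, Fintype.card_congr e]
  · rw [if_neg (fun hh => hp ((posDef_equiv e _).1 hh)), if_neg hp]

lemma cX_equiv (e : V' ≃ V) (p : (V → ℝ) × (V → ℝ)) (i : V') :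
    cX (fun i j => P (e i) (e j)) (fun i => η (e i)) (fun i => p.1 (e i), fun i => p.2 (e i)) i
      = cX P η p (e i) := by
  unfold cX
  simp only
  rw [inv_equiv, inv_equiv]

lemma mp_relabel (e : V' ≃ V) : MeasurePreserving
    (fun x : V → ℝ => (fun i => x (e i) : V' → ℝ)) volume volume :=
  (volume_measurePreserving_piCongrLeft (fun _ : V => ℝ) e).symm

lemma emb_relabel (e : V' ≃ V) : MeasurableEmbedding
    (fun x : V → ℝ => (fun i => x (e i) : V' → ℝ)) :=
  (MeasurableEquiv.piCongrLeft (fun _ : V => ℝ) e).symm.measurableEmbedding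

lemma nu_relabel (e : V' ≃ V) {k : ℕ} (j : Fin k → V')
    (g : (V' → ℝ) × (V' → ℝ) → ℂ) :
    ∫ p : (V' → ℝ) × (V' → ℝ), nuR (fun i j => P (e i) (e j)) (fun i => η (e i)) p •
      ((∏ l, cX (fun i j => P (e i) (e j)) (fun i => η (e i)) p (j l)) * g p)
    = ∫ p : (V → ℝ) × (V → ℝ), nuR P η p • ((∏ l, cX P η p (e (j l)))
        * g (fun i => p.1 (e i), fun i => p.2 (e i))) := by
  have mp : MeasurePreserving (Prod.map (fun x : V → ℝ => (fun i => x (e i) : V' → ℝ))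
      (fun x : V → ℝ => (fun i => x (e i) : V' → ℝ))) volume volume :=
    (mp_relabel e).prod (mp_relabel e)
  rw [← mp.integral_comp
    ((emb_relabel e).prodMap (emb_relabel e))]
  congr 1
  funext p
  change nuR _ _ (fun i => p.1 (e i), fun i => p.2 (e i)) •
    ((∏ l, cX _ _ (fun i => p.1 (e i), fun i => p.2 (e i)) (j l))
      * g (fun i => p.1 (e i), fun i => p.2 (e i))) = _
  rw [nuR_equiv]
  simp only [cX_equiv]

end Relabel

/-! ### Link with the wired graphs -/

section Link
set_option linter.unusedSectionVars false
variable {A : Type*} [Fintype A] [DecidableEq A] {Q : Option A → Option A → ℝ}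

lemma betaW_opt (Q : Option A → Option A → ℝ) (u : A → ℝ) (a : A) :
    betaW Q (opt u 0) (some a) = bF (resP Q) (resw Q) u a := by
  simp only [betaW, bF, Fintype.sum_option, opt, Option.elim, resP, resw, zero_sub]
  ring

lemma thetaW_opt (Q : Option A → Option A → ℝ) (u s : A → ℝ) (a : A) :
    thetaW Q (opt u 0) (opt s 0) (some a) = tF (resP Q) (resw Q) u s a := by
  simp only [thetaW, tF, Hm_mulVec, Fintype.sum_option, opt, Option.elim, resP, resw, bF]
  rw [show 2 * (1 / 2 * (∑ j, Q (some a) (some j) * Real.exp (u j - u a)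
      + Q (some a) none * Real.exp (- u a))) * (Real.exp (u a) * s a)
      = (∑ j, Q (some a) (some j) * Real.exp (u j - u a)) * Real.exp (u a) * s a
        + Q (some a) none * (Real.exp (- u a) * Real.exp (u a)) * s a by ring]
  rw [← Real.exp_add, neg_add_cancel, Real.exp_zero, Finset.sum_mul, Finset.sum_mul]
  rw [add_sub_right_comm, ← Finset.sum_sub_distrib, add_comm]
  congr 1
  · refine Finset.sum_congr rfl fun j _ => ?_
    rw [mul_assoc (Q _ _) (Real.exp (u j - u a)), ← Real.exp_add, sub_add_cancel]
    ring
  · ring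

lemma Amat_opt (hd : ∀ i, Q i i = 0) (u : A → ℝ) (a b : A) :
    Amat Q (opt u 0) (some a) (some b)
      = Real.exp (u a) * Hm (resP Q) (bF (resP Q) (resw Q) u) a b * Real.exp (u b) := by
  simp only [Amat, Matrix.of_apply, Hm, Option.some_inj]
  by_cases hab : a = b
  · subst hab
    simp only [if_true, resP, hd, sub_zero, Fintype.sum_option, opt, Option.elim, bF, resw, add_zero]
    have e : ∀ j, Q (some a) (some j) * Real.exp (u a + u j)
        = Real.exp (u a) * (Q (some a) (some j) * Real.exp (u j - u a)) * Real.exp (u a) := by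
      intro j
      rw [show u a + u j = u a + (u j - u a) + u a by ring, Real.exp_add, Real.exp_add]; ring
    have e2 : Real.exp (u a) = Real.exp (u a) * Real.exp (- u a) * Real.exp (u a) := by
      rw [← Real.exp_add]; simp
    simp only [e, ← Finset.sum_mul, ← Finset.mul_sum]
    rw [show Q (some a) none * Real.exp (u a) = Q (some a) none *
      (Real.exp (u a) * Real.exp (- u a) * Real.exp (u a)) by rw [← e2]]
    ring
  · simp only [hab, if_false, opt, Option.elim, resP, zero_sub, Real.exp_add]
    ring

/-- The non-distinguished vertices. -/
def optNe (A : Type*) : A ≃ {i : Option A // i ≠ none} :=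
  Equiv.ofBijective (fun a => ⟨some a, by simp⟩) ⟨fun a b hab => by simpa using hab, fun i => by
    obtain ⟨i, hi⟩ := i
    cases i with
    | none => exact absurd rfl hi
    | some a => exact ⟨a, rfl⟩⟩

lemma optNe_coe (a : A) : ((optNe A a : {i : Option A // i ≠ none}) : Option A) = some a := rfl

lemma det_AVV (hd : ∀ i, Q i i = 0) (u : A → ℝ) :
    (AVV Q none (opt u 0)).det
      = (∏ a, Real.exp (u a)) ^ 2 * (Hm (resP Q) (bF (resP Q) (resw Q) u)).det := by
  rw [← Matrix.det_submatrix_equiv_self (optNe A)]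
  have e : (AVV Q none (opt u 0)).submatrix (optNe A) (optNe A)
      = Matrix.diagonal (fun a => Real.exp (u a)) * Hm (resP Q) (bF (resP Q) (resw Q) u)
        * Matrix.diagonal (fun a => Real.exp (u a)) := by
    ext a b
    rw [Matrix.mul_diagonal, Matrix.diagonal_mul, Matrix.submatrix_apply]
    exact Amat_opt hd u a b
  rw [e, Matrix.det_mul, Matrix.det_mul, Matrix.det_diagonal]
  ring

lemma rhoW_opt (hs : ∀ i j, Q i j = Q j i) (hd : ∀ i, Q i i = 0) (u s : A → ℝ) :
    rhoW Q none (opt u 0) (opt s 0) *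
      ∏ i : {i : Option A // i ≠ none}, Real.exp (-(opt u 0 i.1)) / (2 * Real.pi)
    = muD (resP Q) (resw Q) (u, s) := by
  have hpi := Real.pi_pos
  rw [← (optNe A).prod_comp]
  simp only [optNe_coe]
  unfold rhoW muD
  rw [det_AVV hd]
  have e1 : ∑ i, ∑ j, opt s 0 i * Amat Q (opt u 0) i j * opt s 0 j
      = (fun i => Real.exp (u i) * s i) ⬝ᵥ tF (resP Q) (resw Q) u s := by
    simp only [Fintype.sum_option, Amat_opt hd]
    simp only [opt, Option.elim, zero_mul, mul_zero, Finset.sum_const_zero, zero_add]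
    simp only [tF, dotProduct, Matrix.mulVec, Finset.mul_sum]
    refine Finset.sum_congr rfl fun i _ => Finset.sum_congr rfl fun j _ => ?_
    ring
  have e2 : (1 / 2) * ∑ i, ∑ j, Q i j * (Real.cosh (opt u 0 i - opt u 0 j) - 1)
      = (1 / 2) * (∑ i, ∑ j, resP Q i j * (Real.cosh (u i - u j) - 1))
        + ∑ i, resw Q i * (Real.cosh (u i) - 1) := by
    simp only [Fintype.sum_option, opt, Option.elim, Finset.sum_add_distrib, hd, zero_mul, zero_add,
      zero_sub, sub_zero, Real.cosh_neg, resP, resw, hs none]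
    ring
  have e3 : ∏ a, Real.exp (-(opt u 0 (some a))) / (2 * Real.pi)
      = (∏ a, Real.exp (u a))⁻¹ / (2 * Real.pi) ^ Fintype.card A := by
    simp only [opt, Option.elim, Real.exp_neg, Finset.prod_div_distrib, Finset.prod_inv_distrib,
      Finset.prod_const, Finset.card_univ]
  rw [e1, e2, e3]
  have h2 : ∏ a, Real.exp (u a) ≠ 0 := (Finset.prod_pos fun i _ => Real.exp_pos _).ne'
  simp only
  field_simp

lemma ext_eq (x : A → ℝ) : extendByZero (none : Option A) (fun i => x ((optNe A).symm i)) = opt x 0 := by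
  funext o
  cases o with
  | none => simp [extendByZero, opt]
  | some a =>
    simp only [extendByZero, opt, Option.elim, reduceCtorEq, dif_neg, not_false_eq_true]
    congr 1
    exact (optNe A).symm_apply_apply a

lemma cont_ext : Continuous (extendByZero (none : Option A)) := by
  refine continuous_pi fun o => ?_
  unfold extendByZero
  split_ifs
  · exact continuous_const
  · fun_prop

lemma continuous_Amat (i j : Option A) : Continuous fun u => Amat Q u i j := by
  simp only [Amat, Matrix.of_apply]
  split_ifs <;> fun_prop

lemma continuous_rho : Continuous fun p : (Option A → ℝ) × (Option A → ℝ) =>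
    rhoW Q none p.1 p.2 *
      ∏ i : {i : Option A // i ≠ none}, Real.exp (-(p.1 i.1)) / (2 * Real.pi) := by
  unfold rhoW
  have h1 : Continuous fun p : (Option A → ℝ) × (Option A → ℝ) => (AVV Q none p.1).det := by
    refine Continuous.matrix_det (continuous_matrix fun i j => ?_)
    exact (continuous_Amat _ _).comp continuous_fst
  have h2 : ∀ i j, Continuous fun p : (Option A → ℝ) × (Option A → ℝ) => Amat Q p.1 i j :=
    fun i j => (continuous_Amat _ _).comp continuous_fst
  have h3 := Real.continuous_cosh
  fun_prop

lemma integral_muW (hs : ∀ i j, Q i j = Q j i) (hd : ∀ i, Q i i = 0)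
    (f : (Option A → ℝ) × (Option A → ℝ) → ℂ) :
    ∫ p, f p ∂(muW Q none) = ∫ p : (A → ℝ) × (A → ℝ), f (opt p.1 0, opt p.2 0)
      ∂(volume.withDensity fun p => ENNReal.ofReal (muD (resP Q) (resw Q) p)) := by
  unfold muW baseMeasure
  rw [integral_withDensity_eq_integral_toReal_smul
    continuous_rho.measurable.ennreal_ofReal
    (Filter.Eventually.of_forall fun _ => ENNReal.ofReal_lt_top)]
  rw [integral_withDensity_eq_integral_toReal_smul
    continuous_muD.measurable.ennreal_ofReal
    (Filter.Eventually.of_forall fun _ => ENNReal.ofReal_lt_top)]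
  have hc : Continuous (fun p : ({i : Option A // i ≠ none} → ℝ) × ({i : Option A // i ≠ none} → ℝ) =>
      (extendByZero none p.1, extendByZero none p.2)) :=
    (cont_ext.comp continuous_fst).prodMk (cont_ext.comp continuous_snd)
  have hinj1 : Function.Injective (extendByZero (none : Option A)) := by
    intro x y hxy
    funext i
    have := congrFun hxy i.1
    simpa [extendByZero, i.2] using this
  have hinj : Function.Injective
      (fun p : ({i : Option A // i ≠ none} → ℝ) × ({i : Option A // i ≠ none} → ℝ) =>
      (extendByZero none p.1, extendByZero none p.2)) := by
    intro x y hxy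
    have := Prod.ext_iff.1 hxy
    exact Prod.ext (hinj1 this.1) (hinj1 this.2)
  rw [(hc.measurableEmbedding hinj).integral_map]
  have mp : MeasurePreserving (Prod.map
      (fun x : A → ℝ => (fun i => x ((optNe A).symm i) : {i : Option A // i ≠ none} → ℝ))
      (fun x : A → ℝ => (fun i => x ((optNe A).symm i) : {i : Option A // i ≠ none} → ℝ)))
      volume volume :=
    (mp_relabel (optNe A).symm).prod (mp_relabel (optNe A).symm)
  rw [← mp.integral_comp
    ((emb_relabel (optNe A).symm).prodMap (emb_relabel (optNe A).symm))]
  congr 1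
  funext p
  simp only [Prod.map, ext_eq]
  rw [rhoW_opt hs hd]

end Link

section Wired
set_option linter.unusedSectionVars false
variable {Vinf : Type*} [DecidableEq Vinf]

lemma wired_symm {W : Vinf → Vinf → ℝ} (hsymm : ∀ i j, W i j = W j i) (S : Finset Vinf) :
    ∀ i j, wiredW W S i j = wiredW W S j i := by
  rintro (_ | i) (_ | j)
  · rfl
  · rfl
  · rfl
  · exact hsymm _ _

lemma wired_diag {W : Vinf → Vinf → ℝ} (hdiag : ∀ i, W i i = 0) (S : Finset Vinf) :
    ∀ i, wiredW W S i i = 0 := by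
  rintro (_ | i)
  · rfl
  · exact hdiag _

lemma W_summable {W : Vinf → Vinf → ℝ} (hnonneg : ∀ i j, 0 ≤ W i j)
    (hlocfin : ∀ i, {j : Vinf | 0 < W i j}.Finite) (i : Vinf) : Summable (W i) := by
  refine summable_of_hasFiniteSupport ((hlocfin i).subset fun j hj => ?_)
  exact lt_of_le_of_ne (hnonneg i j) (Ne.symm hj)

lemma wired_good [Infinite Vinf] {W : Vinf → Vinf → ℝ}
    (hsymm : ∀ i j, W i j = W j i) (hdiag : ∀ i, W i i = 0) (hnonneg : ∀ i j, 0 ≤ W i j)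
    (hlocfin : ∀ i, {j : Vinf | 0 < W i j}.Finite)
    (hconn : (SimpleGraph.fromRel fun i j : Vinf => 0 < W i j).Connected) (S : Finset Vinf) :
    Good (resP (wiredW W S)) (resw (wiredW W S)) where
  symm i j := hsymm _ _
  diag i := hdiag _
  nonneg i j := hnonneg _ _
  eta i := tsum_nonneg fun j => hnonneg _ _
  conn T hT := by
    obtain ⟨t, ht⟩ := hT
    obtain ⟨v, hv⟩ := Infinite.exists_notMem_finset S
    obtain ⟨w⟩ := hconn.preconnected t.1 v
    obtain ⟨d, -, hd1, hd2⟩ := w.exists_boundary_dart (Subtype.val '' T) ⟨t, ht, rfl⟩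
      (by rintro ⟨x, -, rfl⟩; exact hv x.2)
    obtain ⟨i, hi, hi'⟩ := hd1
    have hadj := d.adj
    rw [SimpleGraph.fromRel_adj] at hadj
    have hpos : 0 < W i.1 d.snd := by
      rw [hi']
      rcases hadj.2 with h | h
      · exact h
      · rw [hsymm]; exact h
    refine ⟨i, hi, ?_⟩
    by_cases hS : d.snd ∈ S
    · right
      exact ⟨⟨d.snd, hS⟩, fun hh => hd2 ⟨_, hh, rfl⟩, hpos⟩
    · left
      exact ((W_summable hnonneg hlocfin i.1).subtype _).tsum_pos
        (fun j => hnonneg _ _) (⟨d.snd, hS⟩ : {j : Vinf // j ∉ S}) hpos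

/-- Integral in the `(β,θ)` variables for the wired graph on `S ⊇ Vn`. -/
def NN (W : Vinf → Vinf → ℝ) {Vn : Finset Vinf} {k : ℕ} (jdx : Fin k → {j : Vinf // j ∈ Vn})
    (g : ({j : Vinf // j ∈ Vn} → ℝ) × ({j : Vinf // j ∈ Vn} → ℝ) → ℂ)
    (S : Finset Vinf) (hS : Vn ⊆ S) : ℂ :=
  ∫ p : ({j : Vinf // j ∈ S} → ℝ) × ({j : Vinf // j ∈ S} → ℝ),
    nuR (resP (wiredW W S)) (resw (wiredW W S)) p •
    ((∏ l, cX (resP (wiredW W S)) (resw (wiredW W S)) p ⟨(jdx l).1, hS (jdx l).2⟩)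
      * g (fun j => p.1 ⟨j.1, hS j.2⟩, fun j => p.2 ⟨j.1, hS j.2⟩))

/-- `insert b S` as `S` with one additional vertex. -/
def insE (b : Vinf) (S : Finset Vinf) (hb : b ∉ S) :
    Option {j : Vinf // j ∈ S} ≃ {j : Vinf // j ∈ insert b S} :=
  Equiv.ofBijective (fun o => o.elim ⟨b, Finset.mem_insert_self b S⟩
    (fun x => ⟨x.1, Finset.mem_insert_of_mem x.2⟩)) ⟨by
    rintro (_ | x) (_ | y) hxy
    · rfl
    · exact absurd (congrArg Subtype.val hxy) (fun h : b = y.1 => hb (h ▸ y.2))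
    · exact absurd (congrArg Subtype.val hxy) (fun h : x.1 = b => hb (h ▸ x.2))
    · have : x.1 = y.1 := by simpa using hxy
      rw [Subtype.ext this], by
    rintro ⟨x, hx⟩
    rcases Finset.mem_insert.1 hx with h | h
    · subst h; exact ⟨none, rfl⟩
    · exact ⟨some ⟨x, h⟩, rfl⟩⟩

lemma eta_split {W : Vinf → Vinf → ℝ} (hnonneg : ∀ i j, 0 ≤ W i j)
    (hlocfin : ∀ i, {j : Vinf | 0 < W i j}.Finite) (b : Vinf) (S : Finset Vinf) (hb : b ∉ S)
    (i : Vinf) :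
    (∑' j : {j : Vinf // j ∉ insert b S}, W i j.1) + W i b = ∑' j : {j : Vinf // j ∉ S}, W i j.1 := by
  have hs := W_summable hnonneg hlocfin i
  have h1 := hs.sum_add_tsum_subtype_compl S
  have h2 := hs.sum_add_tsum_subtype_compl (insert b S)
  rw [Finset.sum_insert hb] at h2
  linarith

lemma NN_step [Infinite Vinf] {W : Vinf → Vinf → ℝ}
    (hsymm : ∀ i j, W i j = W j i) (hdiag : ∀ i, W i i = 0) (hnonneg : ∀ i j, 0 ≤ W i j)
    (hlocfin : ∀ i, {j : Vinf | 0 < W i j}.Finite)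
    (hconn : (SimpleGraph.fromRel fun i j : Vinf => 0 < W i j).Connected)
    {Vn : Finset Vinf} {k : ℕ} (jdx : Fin k → {j : Vinf // j ∈ Vn})
    (g : ({j : Vinf // j ∈ Vn} → ℝ) × ({j : Vinf // j ∈ Vn} → ℝ) → ℂ)
    (hg : Measurable g) (hgbd : ∃ C : ℝ, ∀ x, ‖g x‖ ≤ C)
    (S : Finset Vinf) (hS : Vn ⊆ S) (b : Vinf) (hb : b ∉ S) (hS' : Vn ⊆ insert b S) :
    NN W jdx g (insert b S) hS' = NN W jdx g S hS := by
  have hG := wired_good hsymm hdiag hnonneg hlocfin hconn (insert b S)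
  set e := insE b S hb with he
  have h1 := nu_relabel (P := resP (wiredW W (insert b S))) (η := resw (wiredW W (insert b S))) e
    (fun l => some (⟨(jdx l).1, hS (jdx l).2⟩ : {j : Vinf // j ∈ S}))
    (fun p => g (fun j => p.1 (some ⟨j.1, hS j.2⟩), fun j => p.2 (some ⟨j.1, hS j.2⟩)))
  have h2 := step_opt (good_equiv hG e)
    (fun l => (⟨(jdx l).1, hS (jdx l).2⟩ : {j : Vinf // j ∈ S}))
    (fun p => g (fun j => p.1 ⟨j.1, hS j.2⟩, fun j => p.2 ⟨j.1, hS j.2⟩))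
    (hg.comp (by fun_prop)) (by obtain ⟨C, hC⟩ := hgbd; exact ⟨C, fun x => hC _⟩)
  have e1 : resP (fun i j => resP (wiredW W (insert b S)) (e i) (e j)) = resP (wiredW W S) := rfl
  have e2 : resE (fun i j => resP (wiredW W (insert b S)) (e i) (e j))
      (fun i => resw (wiredW W (insert b S)) (e i)) = resw (wiredW W S) := by
    funext i
    exact eta_split hnonneg hlocfin b S hb i.1
  rw [e1, e2] at h2
  unfold NN
  rw [← h2]
  exact h1.symm

lemma NN_union [Infinite Vinf] {W : Vinf → Vinf → ℝ}
    (hsymm : ∀ i j, W i j = W j i) (hdiag : ∀ i, W i i = 0) (hnonneg : ∀ i j, 0 ≤ W i j)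
    (hlocfin : ∀ i, {j : Vinf | 0 < W i j}.Finite)
    (hconn : (SimpleGraph.fromRel fun i j : Vinf => 0 < W i j).Connected)
    {Vn : Finset Vinf} {k : ℕ} (jdx : Fin k → {j : Vinf // j ∈ Vn})
    (g : ({j : Vinf // j ∈ Vn} → ℝ) × ({j : Vinf // j ∈ Vn} → ℝ) → ℂ)
    (hg : Measurable g) (hgbd : ∃ C : ℝ, ∀ x, ‖g x‖ ≤ C) (D : Finset Vinf) :
    ∀ (S : Finset Vinf) (hS : Vn ⊆ S), S = Vn ∪ D →
      NN W jdx g S hS = NN W jdx g Vn (Finset.Subset.refl _) := by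
  induction D using Finset.induction_on with
  | empty =>
    intro S hS hSD
    rw [Finset.union_empty] at hSD
    subst hSD
    rfl
  | insert b D hb ih =>
    intro S hS hSD
    rw [Finset.union_insert] at hSD
    by_cases hbD : b ∈ Vn ∪ D
    · rw [Finset.insert_eq_of_mem hbD] at hSD
      exact ih S hS hSD
    · subst hSD
      rw [NN_step hsymm hdiag hnonneg hlocfin hconn jdx g hg hgbd (Vn ∪ D)
        Finset.subset_union_left b hbD hS]
      exact ih _ _ rfl

lemma muW_NN [Infinite Vinf] {W : Vinf → Vinf → ℝ}
    (hsymm : ∀ i j, W i j = W j i) (hdiag : ∀ i, W i i = 0) (hnonneg : ∀ i j, 0 ≤ W i j)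
    (hlocfin : ∀ i, {j : Vinf | 0 < W i j}.Finite)
    (hconn : (SimpleGraph.fromRel fun i j : Vinf => 0 < W i j).Connected)
    {Vn : Finset Vinf} {k : ℕ} (jdx : Fin k → {j : Vinf // j ∈ Vn})
    (g : ({j : Vinf // j ∈ Vn} → ℝ) × ({j : Vinf // j ∈ Vn} → ℝ) → ℂ)
    (hg : Measurable g) (S : Finset Vinf) (hS : Vn ⊆ S) :
    ∫ p, (∏ l : Fin k,
          (Real.exp (p.1 (some ⟨(jdx l).1, hS (jdx l).2⟩)) : ℂ)
            * (1 + Complex.I * (p.2 (some ⟨(jdx l).1, hS (jdx l).2⟩) : ℂ)))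
        * g ((fun j : {j : Vinf // j ∈ Vn} =>
              betaW (wiredW W S) p.1 (some ⟨j.1, hS j.2⟩)),
            (fun j : {j : Vinf // j ∈ Vn} =>
              thetaW (wiredW W S) p.1 p.2 (some ⟨j.1, hS j.2⟩)))
        ∂(muW (wiredW W S) none) = NN W jdx g S hS := by
  rw [integral_muW (wired_symm hsymm S) (wired_diag hdiag S)]
  have := integral_mu_eq (wired_good hsymm hdiag hnonneg hlocfin hconn S)
    (fun l => (⟨(jdx l).1, hS (jdx l).2⟩ : {j : Vinf // j ∈ S}))
    (fun p => g (fun j => p.1 ⟨j.1, hS j.2⟩, fun j => p.2 ⟨j.1, hS j.2⟩))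
    (hg.comp (by fun_prop))
  unfold NN
  rw [← this]
  simp only [betaW_opt, thetaW_opt]
  rfl

end Wired

/-- hierarchy of martingales, finite-volume identity: for
`j_1,…,j_k ∈ V_n` and bounded Borel measurable `g : ℝ^{V_n}×ℝ^{V_n} → ℂ`,
`∫ ∏_l e^{u_{j_l}}(1+is_{j_l})·g((β^{V_{n+1}}_i)_{i∈V_n},(θ^{V_{n+1}}_i)_{i∈V_n}) dμ^W_{n+1}
 = ∫ ∏_l e^{u_{j_l}}(1+is_{j_l})·g(β^{V_n},θ^{V_n}) dμ^W_n`. -/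
theorem stmt4 {Vinf : Type*} [DecidableEq Vinf] [Infinite Vinf]
    (W : Vinf → Vinf → ℝ)
    (hsymm : ∀ i j, W i j = W j i)
    (hdiag : ∀ i, W i i = 0)
    (hnonneg : ∀ i j, 0 ≤ W i j)
    (hlocfin : ∀ i, {j : Vinf | 0 < W i j}.Finite)
    (hconn : (SimpleGraph.fromRel fun i j : Vinf => 0 < W i j).Connected)
    (Vn Vm : Finset Vinf) (hsub : Vn ⊆ Vm)
    (hconn_n : (SimpleGraph.fromRel
      fun i j : Option {i : Vinf // i ∈ Vn} => 0 < wiredW W Vn i j).Connected)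
    (hconn_m : (SimpleGraph.fromRel
      fun i j : Option {i : Vinf // i ∈ Vm} => 0 < wiredW W Vm i j).Connected)
    (k : ℕ) (jdx : Fin k → {j : Vinf // j ∈ Vn})
    (g : ({j : Vinf // j ∈ Vn} → ℝ) × ({j : Vinf // j ∈ Vn} → ℝ) → ℂ)
    (hg : Measurable g) (hgbd : ∃ C : ℝ, ∀ x, ‖g x‖ ≤ C) :
    ∫ p, (∏ l : Fin k,
          (Real.exp (p.1 (some ⟨(jdx l).1, hsub (jdx l).2⟩)) : ℂ)
            * (1 + Complex.I * (p.2 (some ⟨(jdx l).1, hsub (jdx l).2⟩) : ℂ)))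
        * g ((fun j : {j : Vinf // j ∈ Vn} =>
              betaW (wiredW W Vm) p.1 (some ⟨j.1, hsub j.2⟩)),
            (fun j : {j : Vinf // j ∈ Vn} =>
              thetaW (wiredW W Vm) p.1 p.2 (some ⟨j.1, hsub j.2⟩)))
        ∂(muW (wiredW W Vm) none)
      = ∫ p, (∏ l : Fin k,
          (Real.exp (p.1 (some (jdx l))) : ℂ)
            * (1 + Complex.I * (p.2 (some (jdx l)) : ℂ)))
        * g ((fun j : {j : Vinf // j ∈ Vn} => betaW (wiredW W Vn) p.1 (some j)),
            (fun j : {j : Vinf // j ∈ Vn} => thetaW (wiredW W Vn) p.1 p.2 (some j)))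
        ∂(muW (wiredW W Vn) none) := by
  rw [muW_NN hsymm hdiag hnonneg hlocfin hconn jdx g hg Vm hsub,
    NN_union hsymm hdiag hnonneg hlocfin hconn jdx g hg hgbd Vm Vm hsub
      (Finset.union_eq_right.2 hsub).symm]
  exact (muW_NN hsymm hdiag hnonneg hlocfin hconn jdx g hg Vn (Finset.Subset.refl _)).symm
end
end

section
/- Let V be a finite set, let ζ_V be the measure on ℝ^V×ℝ^V with density (u,s)↦∏_{i∈V}e^{−u_i} with respect to Lebesgue measure, and for a∈(0,∞)^V, b∈ℝ^V let S_{[a,b]}:ℝ^V×ℝ^V→ℝ^V×ℝ^V be given componentwise by S_{[a,b]}(u,s)=((u_i+log a_i)_{i∈V},(s_i−e^{−u_i}b_i/a_i)_{i∈V}). Then the pushforward of ζ_V under S_{[a,b]} equals (∏_{i∈V}a_i)·ζ_V. -/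
open MeasureTheory BigOperators

noncomputable section

/-- The scaling transformation `S_{[a,b]}(u,s) = (u + log a, s − e^{−u} b / a)`,
componentwise. -/
def Smap {V : Type*} (a b : V → ℝ) (p : (V → ℝ) × (V → ℝ)) : (V → ℝ) × (V → ℝ) :=
  (fun i => p.1 i + Real.log (a i),
   fun i => p.2 i - Real.exp (-(p.1 i)) * b i / a i)

/-- The measure `ζ_V` on `ℝ^V × ℝ^V` with density `(u,s) ↦ ∏_{i∈V} e^{−u_i}` with respect
to Lebesgue measure. -/
def zetaV (V : Type*) [Fintype V] : Measure ((V → ℝ) × (V → ℝ)) :=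
  (volume : Measure ((V → ℝ) × (V → ℝ))).withDensity fun p =>
    ENNReal.ofReal (∏ i, Real.exp (-(p.1 i)))

/-- the pushforward of `ζ_V` under `S_{[a,b]}` equals `(∏_{i∈V} a_i)·ζ_V`. -/
theorem stmt5 {V : Type*} [Fintype V]
    (a b : V → ℝ) (ha : ∀ i, 0 < a i) :
    Measure.map (Smap a b) (zetaV V) = ENNReal.ofReal (∏ i, a i) • zetaV V := by
  have hmp : MeasurePreserving (Smap a b) (volume : Measure ((V → ℝ) × (V → ℝ))) volume := by
    have h1 : MeasurePreserving (fun u : V → ℝ => u + fun i => Real.log (a i)) volume volume :=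
      measurePreserving_add_right volume _
    refine h1.skew_product (μb := volume) (μd := volume)
      (g := fun (u s : V → ℝ) => fun i => s i - Real.exp (-(u i)) * b i / a i) ?_ ?_
    · refine measurable_pi_lambda _ fun i => ?_
      simp only [Function.uncurry]
      fun_prop
    · refine Filter.Eventually.of_forall fun u => ?_
      exact (measurePreserving_sub_right (volume : Measure (V → ℝ))
        (fun i => Real.exp (-(u i)) * b i / a i)).map_eq
  have hd : Measurable fun p : (V → ℝ) × (V → ℝ) =>
      ENNReal.ofReal (∏ i, Real.exp (-(p.1 i))) := by fun_prop
  have key : ∀ p : (V → ℝ) × (V → ℝ), ENNReal.ofReal (∏ i, Real.exp (-(p.1 i))) =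
      ENNReal.ofReal (∏ i, a i) *
        ENNReal.ofReal (∏ i, Real.exp (-((Smap a b p).1 i))) := by
    intro p
    rw [← ENNReal.ofReal_mul (Finset.prod_nonneg fun i _ => (ha i).le),
      ← Finset.prod_mul_distrib]
    congr 1
    refine Finset.prod_congr rfl fun i _ => ?_
    have := (ha i).ne'
    simp only [Smap, neg_add, Real.exp_add]
    rw [Real.exp_neg (Real.log (a i)), Real.exp_log (ha i)]
    field_simp
  ext A hA
  rw [Measure.map_apply hmp.measurable hA, Measure.smul_apply, zetaV,
    withDensity_apply _ (hmp.measurable hA), withDensity_apply _ hA,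
    ← hmp.setLIntegral_comp_preimage hA hd, smul_eq_mul,
    ← lintegral_const_mul' _ _ ENNReal.ofReal_ne_top]
  exact lintegral_congr fun p => key p
end
end

section
/- (Ratio of densities.) Let a∈(0,∞)^Ṽ and b∈ℝ^Ṽ with a_δ=1 and b_δ=0. Then for every (u,s)∈Ω_V, ρ^{W^a}(u−log a, s+e^{−u}b) = ρ^W(u,s) · ∏_{(i∼j)∈Ẽ} e^{W_{ij}(a_i a_j+b_i b_j−1)} · ∏_{i∈V} exp(−(a_i²+b_i²−1)β_i(u)−b_iθ_i(u,s)), where (u−log a, s+e^{−u}b) denotes the point with components (u_i−log a_i, s_i+e^{−u_i}b_i)_{i∈Ṽ}, ρ^{W^a} is the density ρ for the rescaled weights W^a_{ij}=a_i a_j W_{ij}. -/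
open MeasureTheory Real Finset BigOperators

noncomputable section

theorem quad_aux {V : Type*} [Fintype V] [DecidableEq V] (W : V → V → ℝ)
    (hdiag : ∀ i, W i i = 0) (u x : V → ℝ) :
    ∑ i, ∑ j, x i * Amat W u i j * x j
      = ∑ i, ∑ j, W i j * Real.exp (u i + u j) * (x i * (x i - x j)) := by
  refine Finset.sum_congr rfl fun i _ => ?_
  have h : ∀ j, x i * Amat W u i j * x j
      = (if i = j then x i * (∑ k, W i k * Real.exp (u i + u k)) * x j else 0)
        - W i j * Real.exp (u i + u j) * (x i * x j) := by
    intro j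
    by_cases hij : i = j
    · subst hij
      simp [Amat, hdiag]
    · simp only [Amat, Matrix.of_apply, if_neg hij]
      ring
  simp only [h, Finset.sum_sub_distrib, Finset.sum_ite_eq, Finset.mem_univ, if_true]
  rw [Finset.mul_sum, Finset.sum_mul, ← Finset.sum_sub_distrib]
  exact Finset.sum_congr rfl fun j _ => by ring

theorem antisymm_aux {V : Type*} [Fintype V] (F : V → V → ℝ)
    (h : ∀ i j, F i j + F j i = 0) : ∑ i, ∑ j, F i j = 0 := by
  have h1 : ∑ i, ∑ j, F i j = ∑ i, ∑ j, F j i := Finset.sum_comm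
  have h2 : ∑ i, ∑ j, F i j + ∑ i, ∑ j, F j i = 0 := by
    simp only [← Finset.sum_add_distrib, h, Finset.sum_const_zero]
  linarith

theorem prod_aux {V : Type*} [Fintype V] [DecidableEq V] (δ : V) (f : V → ℝ) (hf : f δ = 0) :
    ∏ i : {i : V // i ≠ δ}, Real.exp (f i.1) = Real.exp (∑ i, f i) := by
  rw [← Real.exp_sum]
  congr 1
  rw [← Finset.sum_subtype (Finset.univ.filter fun i => i ≠ δ) (by simp) f]
  refine Finset.sum_subset (Finset.subset_univ _) fun i _ hi => ?_
  have : i = δ := by simpa using hi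
  rw [this, hf]

theorem amat_aux {V : Type*} [Fintype V] [DecidableEq V] (W : V → V → ℝ)
    (a : V → ℝ) (ha : ∀ i, 0 < a i) (u : V → ℝ) :
    Amat (fun i j => a i * a j * W i j) (fun i => u i - Real.log (a i)) = Amat W u := by
  have h : ∀ i j, a i * a j * W i j * Real.exp (u i - Real.log (a i) + (u j - Real.log (a j)))
      = W i j * Real.exp (u i + u j) := by
    intro i j
    have h1 := (ha i).ne'
    have h2 := (ha j).ne'
    rw [Real.exp_add, Real.exp_sub, Real.exp_sub, Real.exp_log (ha i), Real.exp_log (ha j),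
      Real.exp_add]
    field_simp
  ext i j
  simp only [Amat, Matrix.of_apply, h]

/-- ratio of densities: for `a ∈ (0,∞)^Ṽ`, `b ∈ ℝ^Ṽ` with `a_δ=1`, `b_δ=0`,
and `(u,s) ∈ Ω_V`:
`ρ^{W^a}(u−log a, s+e^{−u}b) = ρ^W(u,s)·∏_{(i∼j)∈Ẽ} e^{W_{ij}(a_i a_j+b_i b_j−1)}
  ·∏_{i∈V} exp(−(a_i²+b_i²−1)β_i(u) − b_i θ_i(u,s))`,
the edge product being written via a sum over ordered pairs. -/
theorem stmt6 {V : Type*} [Fintype V] [DecidableEq V]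
    (W : V → V → ℝ) (δ : V)
    (hsymm : ∀ i j, W i j = W j i)
    (hdiag : ∀ i, W i i = 0)
    (hnonneg : ∀ i j, 0 ≤ W i j)
    (hconn : (SimpleGraph.fromRel fun i j : V => 0 < W i j).Connected)
    (a b : V → ℝ) (ha : ∀ i, 0 < a i) (haδ : a δ = 1) (hbδ : b δ = 0)
    (u s : V → ℝ) (huδ : u δ = 0) (hsδ : s δ = 0) :
    rhoW (fun i j => a i * a j * W i j) δ
        (fun i => u i - Real.log (a i)) (fun i => s i + Real.exp (-(u i)) * b i)
      = rhoW W δ u s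
        * Real.exp ((1 / 2) * ∑ i, ∑ j, W i j * (a i * a j + b i * b j - 1))
        * ∏ i : {i : V // i ≠ δ},
            Real.exp (-(((a i.1) ^ 2 + (b i.1) ^ 2 - 1) * betaW W u i.1)
              - b i.1 * thetaW W u s i.1) := by
  have hA := amat_aux W a ha u
  rw [prod_aux δ (fun i => -(((a i) ^ 2 + (b i) ^ 2 - 1) * betaW W u i) - b i * thetaW W u s i)
    (by simp [haδ, hbδ])]
  unfold rhoW AVV
  rw [hA]
  rw [quad_aux W hdiag, quad_aux W hdiag]
  set D := (Matrix.of fun i j : {i : V // i ≠ δ} => Amat W u i.1 j.1).det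
  have key : ∀ p q r t w v : ℝ, p + q = r + t + w + v →
      Real.exp p * D * Real.exp q
        = Real.exp r * D * Real.exp t * Real.exp w * Real.exp v := by
    intro p q r t w v h
    have : Real.exp p * Real.exp q = Real.exp r * Real.exp t * Real.exp w * Real.exp v := by
      rw [← Real.exp_add, h, Real.exp_add, Real.exp_add, Real.exp_add]
    linear_combination D * this
  apply key
  rw [← sub_eq_zero]
  simp only [betaW, thetaW, Finset.mul_sum, ← Finset.sum_neg_distrib, ← Finset.sum_add_distrib,
    ← Finset.sum_sub_distrib]
  apply antisymm_aux
  intro i j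
  rw [hsymm j i]
  have h1 := (ha i).ne'
  have h2 := (ha j).ne'
  simp only [Real.cosh_eq, neg_sub, Real.exp_sub, Real.exp_add, Real.exp_neg,
    Real.exp_log (ha i), Real.exp_log (ha j)]
  have e1 := (Real.exp_pos (u i)).ne'
  have e2 := (Real.exp_pos (u j)).ne'
  field_simp
  ring
end
end

section
/- For all real numbers u_i, u_j, s_i, s_j, one has −[cosh(u_i−u_j)−1+(1/2)(s_i−s_j)²e^{u_i+u_j}] = (1/2)·det(e^{u_i}·v_i v_iᵀ − e^{u_j}·v_j v_jᵀ), where v_i denotes the 2×2 real matrix with rows (e^{−u_i}, s_i) and (0, 1), and similarly for v_j. -/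
open Matrix BigOperators

noncomputable section

/-- The 2×2 matrix `v` associated with `(u,s)`: rows `(e^{−u}, s)` and `(0, 1)`. -/
def vmat (u s : ℝ) : Matrix (Fin 2) (Fin 2) ℝ := !![Real.exp (-u), s; 0, 1]

/-- for all reals `u_i, u_j, s_i, s_j`,
`−[cosh(u_i−u_j) − 1 + (1/2)(s_i−s_j)² e^{u_i+u_j}]
 = (1/2)·det(e^{u_i} v_i v_iᵀ − e^{u_j} v_j v_jᵀ)`. -/
theorem stmt11 (ui uj si sj : ℝ) :
    -(Real.cosh (ui - uj) - 1 + (1 / 2) * (si - sj) ^ 2 * Real.exp (ui + uj))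
      = (1 / 2) *
        (Real.exp ui • (vmat ui si * (vmat ui si)ᵀ)
          - Real.exp uj • (vmat uj sj * (vmat uj sj)ᵀ)).det := by
  have ha := Real.exp_ne_zero ui
  have hb := Real.exp_ne_zero uj
  rw [Matrix.det_fin_two, Real.cosh_eq]
  simp only [vmat, Matrix.sub_apply, Matrix.smul_apply, Matrix.mul_apply, Fin.sum_univ_two,
    Matrix.transpose_apply, smul_eq_mul, Matrix.of_apply, Matrix.cons_val_zero,
    Matrix.cons_val_one, Matrix.cons_val', Matrix.cons_val_fin_one]
  rw [neg_sub, Real.exp_sub, Real.exp_sub, Real.exp_add, Real.exp_neg, Real.exp_neg]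
  field_simp
  ring
end
end

section
/- Let a_i, a_j > 0 and b_i, b_j ∈ ℝ, and let v_i = [[a_i, b_i],[0,1]] and v_j = [[a_j, b_j],[0,1]] (2×2 real matrices). Then det(v_i v_iᵀ/a_i − v_j v_jᵀ/a_j) = 2 − ‖v_iᵀ ε v_j‖²/(a_i a_j), where ε = [[0,−1],[1,0]] and ‖·‖ denotes the Euclidean (Frobenius) norm of a 2×2 real matrix. -/
open Matrix BigOperators

noncomputable section

/-- The 2×2 matrix `[[a,b],[0,1]]`. -/
def vab (a b : ℝ) : Matrix (Fin 2) (Fin 2) ℝ := !![a, b; 0, 1]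

/-- The 2×2 matrix `ε = [[0,−1],[1,0]]`. -/
def eps : Matrix (Fin 2) (Fin 2) ℝ := !![0, -1; 1, 0]

/-- for `a_i, a_j > 0` and `b_i, b_j ∈ ℝ`, with `v_i = [[a_i,b_i],[0,1]]`,
`det(v_i v_iᵀ/a_i − v_j v_jᵀ/a_j) = 2 − ‖v_iᵀ ε v_j‖²/(a_i a_j)`, where `‖·‖²` is the
sum of the squares of the entries (squared Frobenius norm). -/
theorem stmt12 (ai aj bi bj : ℝ) (hai : 0 < ai) (haj : 0 < aj) :
    (ai⁻¹ • (vab ai bi * (vab ai bi)ᵀ) - aj⁻¹ • (vab aj bj * (vab aj bj)ᵀ)).det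
      = 2 - (∑ p : Fin 2, ∑ q : Fin 2, (((vab ai bi)ᵀ * eps * vab aj bj) p q) ^ 2)
          / (ai * aj) := by
  have h1 := hai.ne'
  have h2 := haj.ne'
  simp only [Matrix.det_fin_two, Matrix.sub_apply, Matrix.smul_apply, Matrix.mul_apply, Fin.sum_univ_two, Matrix.transpose_apply, smul_eq_mul]
  simp [vab, eps]
  field_simp
  ring
end
end

section
/- Let (u,s)∈Ω_V and let b∈ℝ^Ṽ with b_δ=0. Then ⟨s+e^{−u}b, A^W(u)(s+e^{−u}b)⟩ = ⟨s, A^W(u)s⟩ + ⟨b, H^W_{β̃(u)} b⟩ + 2·Σ_{i∈V} b_i θ_i(u,s), where e^{−u}b denotes the vector (e^{−u_i}b_i)_{i∈Ṽ} and ⟨·,·⟩ the Euclidean scalar product on ℝ^Ṽ. -/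
open Finset BigOperators

noncomputable section

/-- The matrix `H^W_{β̃(u)}`. -/
def Hmat {V : Type*} [Fintype V] [DecidableEq V] (W : V → V → ℝ) (u : V → ℝ) :
    Matrix V V ℝ :=
  Matrix.of fun i j =>
    if i = j then ∑ k, W i k * Real.exp (u k - u i)
    else -(W i j)

theorem quad_row_aux {V : Type*} [Fintype V] [DecidableEq V]
    (C D : V → V → ℝ) (hC : ∀ i, C i i = 0) (x : V → ℝ) :
    ∑ i, ∑ j, x i * (if i = j then ∑ k, D i k else -(C i j)) * x j
      = ∑ i, ∑ j, (D i j * x i * x i - C i j * x i * x j) := by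
  refine Finset.sum_congr rfl fun i _ => ?_
  have h : ∀ j, x i * (if i = j then ∑ k, D i k else -(C i j)) * x j
      = (if i = j then x i * (∑ k, D i k) * x j else 0) - C i j * x i * x j := by
    intro j
    by_cases hij : i = j
    · subst hij
      simp [hC]
    · simp only [hij, if_false]
      ring
  simp only [h, Finset.sum_sub_distrib, Finset.sum_ite_eq, Finset.mem_univ, if_true]
  rw [← Finset.sum_mul, ← Finset.sum_mul]
  ring

/-- for `(u,s) ∈ Ω_V` and `b ∈ ℝ^Ṽ` with `b_δ = 0`,
`⟨s+e^{−u}b, A^W(u)(s+e^{−u}b)⟩ = ⟨s, A^W(u)s⟩ + ⟨b, H^W_{β̃(u)} b⟩ + 2·Σ_{i∈V} b_i θ_i(u,s)`. -/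
theorem stmt14 {V : Type*} [Fintype V] [DecidableEq V]
    (W : V → V → ℝ) (δ : V)
    (hsymm : ∀ i j, W i j = W j i)
    (hdiag : ∀ i, W i i = 0)
    (hnonneg : ∀ i j, 0 ≤ W i j)
    (u s : V → ℝ) (huδ : u δ = 0) (hsδ : s δ = 0)
    (b : V → ℝ) (hbδ : b δ = 0) :
    ∑ i, ∑ j, (s i + Real.exp (-(u i)) * b i) * Amat W u i j
        * (s j + Real.exp (-(u j)) * b j)
      = (∑ i, ∑ j, s i * Amat W u i j * s j)
        + (∑ i, ∑ j, b i * Hmat W u i j * b j)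
        + 2 * ∑ i : {i : V // i ≠ δ}, b i.1 * thetaW W u s i.1 := by
  have hθ : ∑ i : {i : V // i ≠ δ}, b i.1 * thetaW W u s i.1 = ∑ i, b i * thetaW W u s i := by
    rw [← Finset.sum_subtype (Finset.univ.filter fun i => i ≠ δ) (by simp)
      (fun i => b i * thetaW W u s i)]
    refine Finset.sum_subset (Finset.subset_univ _) fun i _ hi => ?_
    have : i = δ := by simpa using hi
    rw [this, hbδ, zero_mul]
  have hA : ∀ x : V → ℝ, ∑ i, ∑ j, x i * Amat W u i j * x j = _ := fun x =>
    quad_row_aux (fun i j => W i j * Real.exp (u i + u j))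
      (fun i j => W i j * Real.exp (u i + u j)) (by simp [hdiag]) x
  have hH : ∑ i, ∑ j, b i * Hmat W u i j * b j = _ :=
    quad_row_aux W (fun i j => W i j * Real.exp (u j - u i)) hdiag b
  have hanti : ∑ i, ∑ j, W i j * (b i * Real.exp (u j) * s j)
      = ∑ i, ∑ j, W i j * (b j * Real.exp (u i) * s i) := by
    rw [Finset.sum_comm]
    refine Finset.sum_congr rfl fun i _ => Finset.sum_congr rfl fun j _ => ?_
    rw [hsymm j i]
  rw [hθ, hA (fun i => s i + Real.exp (-(u i)) * b i), hA s, hH, ← sub_eq_zero]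
  rw [← sub_eq_zero] at hanti
  rw [← hanti]
  simp only [thetaW, Finset.mul_sum, ← Finset.sum_add_distrib, ← Finset.sum_sub_distrib]
  refine Finset.sum_congr rfl fun i _ => Finset.sum_congr rfl fun j _ => ?_
  have hi := Real.exp_ne_zero (u i)
  have hj := Real.exp_ne_zero (u j)
  simp only [Real.exp_add, Real.exp_sub, Real.exp_neg]
  field_simp
  ring
end
end
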